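/- arXiv:1904.10336 — 8 statements merged into one kernel-verified Lean document; each statement's English description precedes it below -/
import Mathlib

section
/- Let L be a first-order language, T an L-theory and φ(x,y) an L-formula with its free variables partitioned into tuples x and y. Then φ is NIP in T if and only if φ has uniform definability of types over finite sets (UDTFS) in T. -/
open FirstOrder Language

universe u v

/-- A family of subsets `F` of `X` shatters `B` if every subset of `B` is cut out by a
member of `F`. -/
def SetShatters {X : Type*} (F : Set (Set X)) (B : Set X) : Prop :=
  ∀ S ⊆ B, ∃ f ∈ F, f ∩ B = S

/-- The VC dimension of the family `F` is at most `n`: no finite set of size `> n` is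
shattered by `F`. -/
def VCDimLE {X : Type*} (F : Set (Set X)) (n : ℕ) : Prop :=
  ∀ B : Finset X, SetShatters F ↑B → B.card ≤ n

/-- The family of definable sets `φ(M, a)` for `a ∈ M^y`. -/
def defFamily {L : FirstOrder.Language.{u, v}} {α β : Type*} (φ : L.Formula (α ⊕ β))
    (M : Type (max u v)) [L.Structure M] : Set (Set (α → M)) :=
  { S | ∃ a : β → M, S = { b : α → M | φ.Realize (Sum.elim b a) } }

/-- `φ(x, y)` is NIP in `T`: in every model of `T`, the family of sets defined by the
instances `φ(x, a)` has finite VC dimension. -/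
def FormulaNIP {L : FirstOrder.Language.{u, v}} {α β : Type*} (T : L.Theory)
    (φ : L.Formula (α ⊕ β)) : Prop :=
  ∀ (M : Type (max u v)) [L.Structure M] [Nonempty M], M ⊨ T →
    ∃ n : ℕ, VCDimLE (defFamily φ M) n

/-- `p` (given as the set of parameters `a ∈ A` with `φ(x,a) ∈ p`) is a (consistent,
complete) `φ`-type over `A`: every finite fragment of it is realized in `M`. -/
def IsPhiType {L : FirstOrder.Language.{u, v}} {α β : Type*} {M : Type (max u v)} [L.Structure M]
    (φ : L.Formula (α ⊕ β)) (A : Set (β → M)) (p : Set (β → M)) : Prop :=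
  p ⊆ A ∧ ∀ A₀ : Finset (β → M), ↑A₀ ⊆ A →
    ∃ b : α → M, ∀ a ∈ A₀, (φ.Realize (Sum.elim b a) ↔ a ∈ p)

/-- `ψ(y, c)` defines the `φ`-type `p` over `A`, where `c` is a tuple of `k` elements
of `M^y`. -/
def DefinesType {L : FirstOrder.Language.{u, v}} {β : Type*} {k : ℕ} {M : Type (max u v)}
    [L.Structure M] (ψ : L.Formula (β ⊕ (Fin k × β))) (c : Fin k → β → M)
    (A p : Set (β → M)) : Prop :=
  ∀ a ∈ A, (ψ.Realize (Sum.elim a fun iz => c iz.1 iz.2) ↔ a ∈ p)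

/-- `φ(x, y)` has uniform definability of types over finite sets in `T`. -/
def UDTFS {L : FirstOrder.Language.{u, v}} {α β : Type*} (T : L.Theory)
    (φ : L.Formula (α ⊕ β)) : Prop :=
  ∃ (k : ℕ) (ψ : L.Formula (β ⊕ (Fin k × β))),
    ∀ (M : Type (max u v)) [L.Structure M] [Nonempty M], M ⊨ T →
      ∀ A : Set (β → M), A.Finite → 2 ≤ A.ncard →
        ∀ p : Set (β → M), IsPhiType φ A p →
          ∃ c : Fin k → β → M, (∀ i, c i ∈ A) ∧ DefinesType ψ c A p

/-- The relation `R`, seen as a family of subsets of `X` indexed by `Y`, shatters some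
`k`-tuple of points of `X`. -/
def RelShatters {X Y : Type*} (R : X → Y → Prop) (k : ℕ) : Prop :=
  ∃ x : Fin k → X, ∀ s : Set (Fin k), ∃ y : Y, ∀ i, R (x i) y ↔ i ∈ s

section Shattering

variable {X Y : Type*} {R : X → Y → Prop} {k : ℕ}

theorem RelShatters.injective {x : Fin k → X}
    (hx : ∀ s : Set (Fin k), ∃ y : Y, ∀ i, R (x i) y ↔ i ∈ s) : Function.Injective x := by
  intro i j hij
  obtain ⟨y, hy⟩ := hx {j}
  have hi := hy i
  rw [hij, hy j] at hi
  simpa using hi.symm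

theorem RelShatters.flip (h : RelShatters R (2 ^ k)) : RelShatters (fun y x => R x y) k := by
  obtain ⟨x, hx⟩ := h
  have e : Set (Fin k) ≃ Fin (2 ^ k) := Fintype.equivFinOfCardEq (by simp)
  choose y hy using fun i : Fin k => hx {j | i ∈ e.symm j}
  exact ⟨y, fun s => ⟨x (e s), fun i => by simp [hy]⟩⟩

theorem RelShatters.of_xor {p : X → Prop} (h : RelShatters (fun x y => (R x y ↔ p x)) k) :
    RelShatters R k := by
  obtain ⟨x, hx⟩ := h
  refine ⟨x, fun s => ?_⟩
  obtain ⟨y, hy⟩ := hx {i | i ∈ s ↔ p (x i)}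
  refine ⟨y, fun i => ?_⟩
  have := hy i
  simp only [Set.mem_ofPred_eq] at this
  tauto

end Shattering

/-- A family over a finite type which shatters no set with more than `k` elements has
polynomially many members. -/
theorem Finset.card_le_pow_of_shatters {ι : Type*} [Fintype ι] [DecidableEq ι]
    (𝒯 : Finset (Finset ι)) (k : ℕ) (h : ∀ s, 𝒯.Shatters s → s.card ≤ k) :
    𝒯.card ≤ (Fintype.card ι + 1) ^ k := by
  have hd : 𝒯.vcDim ≤ k := Finset.sup_le fun s hs => h s (Finset.mem_shatterer.1 hs)
  calc 𝒯.card ≤ 𝒯.shatterer.card := Finset.card_le_card_shatterer 𝒯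
    _ ≤ ∑ j ∈ Finset.Iic 𝒯.vcDim, (Fintype.card ι).choose j := Finset.card_shatterer_le_sum_vcDim
    _ ≤ ∑ j ∈ Finset.range (k + 1), (Fintype.card ι).choose j := by
        refine Finset.sum_le_sum_of_subset fun j hj => ?_
        simp only [Finset.mem_Iic, Finset.mem_range] at *
        omega
    _ ≤ ∑ j ∈ Finset.range (k + 1), Fintype.card ι ^ j * 1 ^ (k - j) * k.choose j := by
        refine Finset.sum_le_sum fun j hj => ?_
        have : 0 < k.choose j := Nat.choose_pos (by simp at hj; omega)
        calc (Fintype.card ι).choose j ≤ Fintype.card ι ^ j := Nat.choose_le_pow _ _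
          _ ≤ _ := by simpa using Nat.le_mul_of_pos_right _ this
    _ = (Fintype.card ι + 1) ^ k := (add_pow _ _ _).symm

/-- **Teaching sets for classes of finite VC dimension.** Some member of a finite nonempty
class shattering no `d`-tuple is isolated in the class by boundedly many points. -/
theorem exists_teaching_set (d : ℕ) : ∃ r : ℕ, ∀ (X Y : Type u) [Finite Y] [Nonempty Y]
    (R : X → Y → Prop), ¬ RelShatters R d →
      ∃ (y : Y) (W : Finset X), W.card ≤ r ∧
        ∀ y', (∀ x ∈ W, R x y' ↔ R x y) → ∀ x, R x y' ↔ R x y := by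
  classical
  induction d with
  | zero =>
    refine ⟨0, fun X Y _ hY R h => (h ⟨Fin.elim0, fun s => ?_⟩).elim⟩
    exact ⟨hY.some, fun i => i.elim0⟩
  | succ d ih =>
    obtain ⟨r, hr⟩ := ih
    rcases Nat.eq_zero_or_pos d with rfl | hd
    · refine ⟨0, fun X Y _ hY R h => ⟨hY.some, ∅, by simp, fun y' _ x => ?_⟩⟩
      by_contra hne
      refine h ⟨fun _ => x, fun s => ?_⟩
      by_cases h0 : (R x y' ↔ (0 : Fin 1) ∈ s)
      · exact ⟨y', fun i => by rw [Subsingleton.elim (α := Fin 1) i 0]; exact h0⟩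
      · exact ⟨hY.some, fun i => by rw [Subsingleton.elim (α := Fin 1) i 0]; tauto⟩
    set k := d * 2 ^ d with hk
    refine ⟨k + r, fun X Y _ hY R h => ?_⟩
    let C : Finset X → Y → Set Y := fun I y₀ => {y | ∀ x ∈ I, R x y ↔ R x y₀}
    obtain ⟨S, ⟨I, y₀, hIk, rfl⟩, hmin⟩ :=
      (Set.toFinite {S : Set Y | ∃ I y₀, I.card ≤ k ∧ S = C I y₀}).exists_minimal
        ⟨_, ∅, hY.some, by simp, rfl⟩
    have hmin' : ∀ I' y', I'.card ≤ k → C I' y' ⊆ C I y₀ → C I y₀ ⊆ C I' y' :=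
      fun I' y' hc hs => hmin ⟨I', y', hc, rfl⟩ hs
    rcases hIk.lt_or_eq with hlt | heq
    · refine ⟨y₀, I, by omega, fun y' hy' x => ?_⟩
      refine hmin' (insert x I) y₀ ((Finset.card_insert_le _ _).trans hlt)
        (fun y hy z hz => hy z (Finset.mem_insert_of_mem hz)) hy' x (Finset.mem_insert_self _ _)
    by_cases hsh : RelShatters (fun x (y : C I y₀) => R x y) d
    swap
    · have : Nonempty (C I y₀) := ⟨⟨y₀, fun x _ => Iff.rfl⟩⟩
      obtain ⟨y₁, W, hW, hW'⟩ := hr X (C I y₀) _ hsh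
      refine ⟨y₁, I ∪ W, (Finset.card_union_le _ _).trans (by omega), fun y' hy' x => ?_⟩
      have hy'C : y' ∈ C I y₀ := fun z hz =>
        (hy' z (Finset.mem_union_left _ hz)).trans (y₁.2 z hz)
      exact hW' ⟨y', hy'C⟩ (fun z hz => hy' z (Finset.mem_union_right _ hz)) x
    exfalso
    obtain ⟨x, hx⟩ := hsh
    choose ys hys using hx
    have hforced : ∀ i : X, ∃ s : Set (Fin d), i ∈ I →
        ∀ y, (∀ j, R (x j) y ↔ j ∈ s) → (R i y ↔ R i y₀) := by
      intro i
      by_contra! hcon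
      refine h ⟨Fin.cons i x, fun S => ?_⟩
      obtain ⟨hi, y, hy, hy'⟩ := hcon {j | j.succ ∈ S}
      by_cases h0 : (R i y₀ ↔ (0 : Fin (d + 1)) ∈ S)
      · refine ⟨ys {j | j.succ ∈ S}, fun j => ?_⟩
        refine Fin.cases ?_ (fun j => ?_) j
        · simpa using ((ys {j | j.succ ∈ S}).2 i hi).trans h0
        · simpa using hys {j | j.succ ∈ S} j
      · refine ⟨y, fun j => ?_⟩
        refine Fin.cases ?_ (fun j => ?_) j
        · simp only [Fin.cons_zero]
          tauto
        · simpa using hy j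
    choose σ hσ using hforced
    obtain ⟨s, -, hs⟩ := Finset.exists_le_card_fiber_of_mul_le_card_of_maps_to
      (s := I) (t := (Finset.univ : Finset (Set (Fin d)))) (f := σ) (n := d)
      (fun _ _ => Finset.mem_univ _) ⟨∅, Finset.mem_univ _⟩ (by simp [heq, hk, mul_comm])
    have hcard : ((I.filter fun i => ¬ σ i = s) ∪ Finset.univ.image x).card ≤ k := by
      have h1 := Finset.card_filter_add_card_filter_not (s := I) (fun i => σ i = s)
      have h2 := Finset.card_union_le (I.filter fun i => ¬ σ i = s) (Finset.univ.image x)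
      have h3 : (Finset.univ.image x).card ≤ d := by
        simpa using Finset.card_image_le (s := Finset.univ) (f := x)
      omega
    have hsub := hmin' _ (ys s).1 hcard (fun y hy i hi => by
      by_cases hi' : σ i = s
      · refine hσ i hi y fun j => ?_
        rw [hi', hy (x j) (by simp)]
        exact hys s j
      · rw [hy i (by simp [hi, hi'])]
        exact (ys s).2 i hi)
    have h1 := hsub (ys sᶜ).2 (x ⟨0, hd⟩) (by simp)
    have h2 := hys s ⟨0, hd⟩
    have h3 := hys sᶜ ⟨0, hd⟩
    simp only [Set.mem_compl_iff] at h3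
    tauto

open Classical in
/-- The real-valued truth value of a proposition. -/
noncomputable def truthValue (p : Prop) : ℝ := if p then 1 else 0

theorem truthValue_nonneg (p : Prop) : 0 ≤ truthValue p := by
  unfold truthValue; split_ifs <;> norm_num

theorem truthValue_le_one (p : Prop) : truthValue p ≤ 1 := by
  unfold truthValue; split_ifs <;> norm_num

theorem truthValue_not (p : Prop) : truthValue (¬ p) = 1 - truthValue p := by
  unfold truthValue; split_ifs <;> simp_all

/-- Exponential moment bound for a sum of differences of truth values with random signs,
uniformly over a class of finite VC dimension. -/
theorem sum_signs_iSup_le {X Y : Type*} [Finite Y] [Nonempty Y] {R : X → Y → Prop} {k n : ℕ}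
    (hR : ¬ RelShatters R k) (ε : ℝ) (z : Fin n → X × X) :
    ∑ σ : Fin n → Bool, ⨆ y : Y, Real.exp (ε * ∑ i, (if σ i then (-1 : ℝ) else 1) *
        (truthValue (R (z i).1 y) - truthValue (R (z i).2 y))) ≤
      (2 * n + 1) ^ k * (2 ^ n * Real.exp (n * (ε ^ 2 / 2))) := by
  classical
  let pt : Fin n × Bool → X := fun q => cond q.2 (z q.1).1 (z q.1).2
  let tr : Y → Finset (Fin n × Bool) := fun y => Finset.univ.filter fun q => R (pt q) y
  let 𝒯 : Finset (Finset (Fin n × Bool)) := Finset.univ.filter fun τ => ∃ y, tr y = τ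
  let δ : Finset (Fin n × Bool) → Fin n → ℝ :=
    fun τ i => truthValue ((i, true) ∈ τ) - truthValue ((i, false) ∈ τ)
  have hδ : ∀ y i, truthValue (R (z i).1 y) - truthValue (R (z i).2 y) = δ (tr y) i := by
    intro y i
    simp [δ, tr, pt]
  have hcard : (𝒯.card : ℝ) ≤ (2 * n + 1) ^ k := by
    have : 𝒯.card ≤ (Fintype.card (Fin n × Bool) + 1) ^ k := by
      refine Finset.card_le_pow_of_shatters 𝒯 k fun s hs => ?_
      by_contra! hlt
      obtain ⟨s', hs's, hs'k⟩ := Finset.exists_subset_card_eq hlt.le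
      let e := s'.equivFinOfCardEq hs'k
      refine hR ⟨fun i => pt (e.symm i), fun S => ?_⟩
      obtain ⟨τ, hτ, hτs⟩ := (hs.mono_right hs's)
        (t := s'.attach.filter (fun q => e q ∈ S) |>.map (Function.Embedding.subtype _))
        (by intro q hq; simp at hq; exact hq.1)
      obtain ⟨y, rfl⟩ := (Finset.mem_filter.1 hτ).2
      refine ⟨y, fun i => ?_⟩
      have := congrArg (fun t => (e.symm i).1 ∈ t) hτs
      simpa [tr] using this
    have h2 : Fintype.card (Fin n × Bool) + 1 = 2 * n + 1 := by simp [mul_comm]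
    rw [h2] at this
    exact_mod_cast this
  have hbound : ∀ τ i, Real.exp (-(ε * δ τ i)) + Real.exp (ε * δ τ i) ≤
      2 * Real.exp (ε ^ 2 / 2) := by
    intro τ i
    have h1 : Real.cosh (ε * δ τ i) ≤ Real.exp ((ε * δ τ i) ^ 2 / 2) :=
      Real.cosh_le_exp_half_sq _
    have h2 : δ τ i ^ 2 ≤ 1 := by
      rw [sq_le_one_iff_abs_le_one, abs_le]
      have := truthValue_nonneg ((i, true) ∈ τ)
      have := truthValue_nonneg ((i, false) ∈ τ)
      have := truthValue_le_one ((i, true) ∈ τ)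
      have := truthValue_le_one ((i, false) ∈ τ)
      constructor <;> simp only [δ] <;> linarith
    have h3 : Real.exp ((ε * δ τ i) ^ 2 / 2) ≤ Real.exp (ε ^ 2 / 2) := by
      rw [Real.exp_le_exp, mul_pow]
      nlinarith [sq_nonneg ε]
    rw [Real.cosh_eq] at h1
    linarith
  calc _ ≤ ∑ σ : Fin n → Bool, ∑ τ ∈ 𝒯,
        ∏ i, Real.exp (ε * ((if σ i then (-1 : ℝ) else 1) * δ τ i)) := by
        refine Finset.sum_le_sum fun σ _ => ciSup_le fun y => ?_
        simp_rw [hδ, Finset.mul_sum, Real.exp_sum]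
        refine Finset.single_le_sum (f := fun τ => ∏ i, Real.exp (ε * ((if σ i then (-1 : ℝ) else 1) * δ τ i)))
          (fun τ _ => Finset.prod_nonneg fun i _ => (Real.exp_pos _).le) ?_
        simp [𝒯]
    _ = ∑ τ ∈ 𝒯, ∏ i, ∑ b : Bool, Real.exp (ε * ((if b then (-1 : ℝ) else 1) * δ τ i)) := by
        rw [Finset.sum_comm]
        refine Finset.sum_congr rfl fun τ _ => ?_
        rw [Finset.prod_univ_sum, Fintype.piFinset_univ]
    _ ≤ ∑ τ ∈ 𝒯, ∏ _i : Fin n, 2 * Real.exp (ε ^ 2 / 2) := by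
        refine Finset.sum_le_sum fun τ _ => Finset.prod_le_prod (fun i _ => ?_) fun i _ => ?_
        · exact Finset.sum_nonneg fun b _ => (Real.exp_pos _).le
        · simpa using hbound τ i
    _ = 𝒯.card * (2 ^ n * Real.exp (n * (ε ^ 2 / 2))) := by
        simp [mul_pow, Real.exp_nat_mul]
    _ ≤ _ := by gcongr

theorem sum_prod_mul_exp_ge {X : Type*} [Fintype X] {w : X → ℝ} (hw : w ∈ stdSimplex ℝ X)
    (n : ℕ) (ε : ℝ) (f : X → ℝ) :
    Real.exp (ε * (n * ∑ a, w a * f a)) ≤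
      ∑ x : Fin n → X, (∏ i, w (x i)) * Real.exp (ε * ∑ i, f (x i)) := by
  have h1 : ∑ x : Fin n → X, (∏ i, w (x i)) * Real.exp (ε * ∑ i, f (x i)) =
      (∑ a, w a * Real.exp (ε * f a)) ^ n := by
    classical
    simp_rw [Finset.mul_sum, Real.exp_sum, ← Finset.prod_mul_distrib]
    have := Finset.prod_univ_sum (fun _ : Fin n => Finset.univ)
      (fun _ a => w a * Real.exp (ε * f a))
    rw [Fintype.piFinset_univ] at this
    simp [← this]
  have h2 := convexOn_exp.map_sum_le (t := Finset.univ) (w := w) (p := fun a => ε * f a)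
    (fun a _ => hw.1 a) hw.2 (fun _ _ => Set.mem_univ _)
  simp only [smul_eq_mul] at h2
  rw [h1]
  calc Real.exp (ε * (n * ∑ a, w a * f a)) = Real.exp (∑ a, w a * (ε * f a)) ^ n := by
        rw [← Real.exp_nat_mul]
        congr 1
        rw [mul_left_comm, Finset.mul_sum]
        congr 1
        exact Finset.sum_congr rfl fun a _ => by ring
    _ ≤ _ := by gcongr

theorem exists_nat_pow_lt_exp (k : ℕ) {c : ℝ} (hc : 0 < c) :
    ∃ n : ℕ, 0 < n ∧ (2 * n + 1 : ℝ) ^ k < Real.exp (n * c) := by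
  have h1 := (isLittleO_pow_exp_pos_mul_atTop k (b := c / 4) (by positivity)).def one_pos
  have h2 : Filter.Tendsto (fun n : ℕ => (2 * n + 1 : ℝ)) Filter.atTop Filter.atTop :=
    Filter.tendsto_atTop_add_const_right _ _
      (tendsto_natCast_atTop_atTop.const_mul_atTop two_pos)
  obtain ⟨n, hn, hn0⟩ := ((h2.eventually h1).and (Filter.eventually_gt_atTop 0)).exists
  refine ⟨n, hn0, ?_⟩
  rw [one_mul, Real.norm_of_nonneg (by positivity), Real.norm_of_nonneg (by positivity)] at hn
  refine hn.trans_lt (Real.exp_lt_exp.2 ?_)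
  have : (1 : ℝ) ≤ n := by exact_mod_cast hn0
  nlinarith

/-- **Uniform approximation** for classes of finite VC dimension: every finitely supported
probability distribution is uniformly dominated, up to `ε`, by the empirical distribution of
a sample whose size depends only on `ε` and the VC dimension. -/
theorem exists_approximation (k : ℕ) {ε : ℝ} (hε : 0 < ε) : ∃ n : ℕ, 0 < n ∧
    ∀ (X Y : Type u) [Fintype X] [Finite Y] (R : X → Y → Prop), ¬ RelShatters R k →
      ∀ w ∈ stdSimplex ℝ X, ∃ x : Fin n → X, ∀ y,
        ∑ a, w a * truthValue (R a y) ≤ (∑ i, truthValue (R (x i) y)) / n + ε := by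
  obtain ⟨n, hn, hnk⟩ := exists_nat_pow_lt_exp k (c := ε ^ 2 / 2) (by positivity)
  refine ⟨n, hn, fun X Y _ _ R hR w hw => ?_⟩
  by_contra! hcon
  have hX : Nonempty X := by
    by_contra hX
    rw [not_nonempty_iff] at hX
    simpa using hw.2
  choose ybad hbad using hcon
  have hY : Nonempty Y := ⟨ybad fun _ => hX.some⟩
  let D : X × X → Y → ℝ := fun q y => truthValue (R q.1 y) - truthValue (R q.2 y)
  let G : (Fin n → X × X) → ℝ := fun z => ⨆ y, Real.exp (ε * ∑ i, D (z i) y)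
  let W : (Fin n → X × X) → ℝ := fun z => ∏ i, (w (z i).1 * w (z i).2)
  have hW0 : ∀ z, 0 ≤ W z := fun z =>
    Finset.prod_nonneg fun i _ => mul_nonneg (hw.1 _) (hw.1 _)
  have hpow : ∑ x : Fin n → X, ∏ i, w (x i) = 1 := by
    classical
    rw [← Fintype.piFinset_univ, ← Finset.prod_univ_sum]
    simp [hw.2]
  have hsplit : ∀ F : (Fin n → X × X) → ℝ, ∑ z, W z * F z =
      ∑ x : Fin n → X, (∏ i, w (x i)) * ∑ x' : Fin n → X,
        (∏ i, w (x' i)) * F fun i => (x' i, x i) := by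
    intro F
    simp_rw [Finset.mul_sum]
    rw [← Fintype.sum_prod_type', ← (((Equiv.arrowProdEquivProdArrow (Fin n) (fun _ => X)
      (fun _ => X)).trans (Equiv.prodComm _ _)).sum_comp)]
    refine Finset.sum_congr rfl fun z _ => ?_
    simp [W, Equiv.arrowProdEquivProdArrow, Finset.prod_mul_distrib]
    ring
  have hWsum : ∑ z, W z = 1 := by
    have := hsplit fun _ => 1
    simpa [hpow] using this
  have hlower : Real.exp (n * ε ^ 2) ≤ ∑ z, W z * G z := by
    rw [hsplit]
    calc Real.exp (n * ε ^ 2)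
        = ∑ x : Fin n → X, (∏ i, w (x i)) * Real.exp (n * ε ^ 2) := by
          rw [← Finset.sum_mul, hpow, one_mul]
      _ ≤ _ := by
          refine Finset.sum_le_sum fun x _ => ?_
          refine mul_le_mul_of_nonneg_left ?_ (Finset.prod_nonneg fun i _ => hw.1 _)
          set y := ybad x with hy
          have hb : n * ε ≤ n * ∑ a, w a * truthValue (R a y) -
              ∑ i, truthValue (R (x i) y) := by
            have hn' : (0 : ℝ) < n := by exact_mod_cast hn
            have := mul_lt_mul_of_pos_left (hbad x) hn'
            rw [mul_add, mul_div_cancel₀ _ hn'.ne'] at this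
            linarith
          calc Real.exp (n * ε ^ 2)
              ≤ Real.exp (ε * (n * ∑ a, w a * truthValue (R a y))) *
                Real.exp (-(ε * ∑ i, truthValue (R (x i) y))) := by
                rw [← Real.exp_add, Real.exp_le_exp]
                nlinarith
            _ ≤ (∑ x' : Fin n → X, (∏ i, w (x' i)) *
                  Real.exp (ε * ∑ i, truthValue (R (x' i) y))) *
                Real.exp (-(ε * ∑ i, truthValue (R (x i) y))) := by
                gcongr
                exact sum_prod_mul_exp_ge hw n ε fun a => truthValue (R a y)
            _ = ∑ x' : Fin n → X, (∏ i, w (x' i)) *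
                  Real.exp (ε * ∑ i, D (x' i, x i) y) := by
                rw [Finset.sum_mul]
                refine Finset.sum_congr rfl fun x' _ => ?_
                rw [mul_assoc, ← Real.exp_add]
                simp only [D, Finset.sum_sub_distrib]
                ring_nf
            _ ≤ _ := by
                refine Finset.sum_le_sum fun x' _ => ?_
                refine mul_le_mul_of_nonneg_left ?_ (Finset.prod_nonneg fun i _ => hw.1 _)
                exact le_ciSup (f := fun y => Real.exp (ε * ∑ i, D (x' i, x i) y))
                  (Set.finite_range _).bddAbove y
  let sw : (Fin n → Bool) → (Fin n → X × X) ≃ (Fin n → X × X) := fun σ =>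
    Equiv.piCongrRight fun i => if σ i then Equiv.prodComm X X else Equiv.refl _
  have hswap : ∀ σ : Fin n → Bool, ∑ z, W z * G z = ∑ z, W z * ⨆ y, Real.exp (ε * ∑ i,
      (if σ i then (-1 : ℝ) else 1) * D (z i) y) := by
    intro σ
    rw [← (sw σ).sum_comp]
    refine Finset.sum_congr rfl fun z _ => ?_
    have h1 : W (sw σ z) = W z := by
      refine Finset.prod_congr rfl fun i _ => ?_
      by_cases h : σ i <;> simp [sw, h, mul_comm]
    have h2 : ∀ y i, D (sw σ z i) y = (if σ i then (-1 : ℝ) else 1) * D (z i) y := by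
      intro y i
      by_cases h : σ i <;> simp [sw, h, D]
    simp only [G, h1, h2]
  have hupper : 2 ^ n * ∑ z, W z * G z ≤
      (2 * n + 1) ^ k * (2 ^ n * Real.exp (n * (ε ^ 2 / 2))) := by
    calc 2 ^ n * ∑ z, W z * G z = ∑ _σ : Fin n → Bool, ∑ z, W z * G z := by simp
      _ = ∑ σ : Fin n → Bool, ∑ z, W z * ⨆ y, Real.exp (ε * ∑ i,
          (if σ i then (-1 : ℝ) else 1) * D (z i) y) :=
          Finset.sum_congr rfl fun σ _ => hswap σ
      _ = ∑ z, W z * ∑ σ : Fin n → Bool, ⨆ y, Real.exp (ε * ∑ i,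
          (if σ i then (-1 : ℝ) else 1) * D (z i) y) := by
          rw [Finset.sum_comm]
          exact Finset.sum_congr rfl fun z _ => (Finset.mul_sum _ _ _).symm
      _ ≤ ∑ z, W z * ((2 * n + 1) ^ k * (2 ^ n * Real.exp (n * (ε ^ 2 / 2)))) :=
          Finset.sum_le_sum fun z _ =>
            mul_le_mul_of_nonneg_left (sum_signs_iSup_le hR ε z) (hW0 z)
      _ = _ := by rw [← Finset.sum_mul, hWsum, one_mul]
  have h2n : (0 : ℝ) < 2 ^ n := by positivity
  have h3 : Real.exp (n * ε ^ 2) ≤ (2 * n + 1) ^ k * Real.exp (n * (ε ^ 2 / 2)) := by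
    refine hlower.trans (le_of_mul_le_mul_left ?_ h2n)
    linarith
  have h4 : Real.exp (n * ε ^ 2) =
      Real.exp (n * (ε ^ 2 / 2)) * Real.exp (n * (ε ^ 2 / 2)) := by
    rw [← Real.exp_add]; ring_nf
  rw [h4] at h3
  exact absurd (le_of_mul_le_mul_right h3 (Real.exp_pos _)) (not_le.2 hnk)

/-- **Minimax theorem** for a finite zero-sum game. -/
theorem exists_mixed_strategy {X H : Type*} [Fintype X] [Fintype H] [Nonempty X]
    (m : H → X → ℝ) (c : ℝ)
    (h : ∀ w ∈ stdSimplex ℝ X, ∃ q, c ≤ ∑ a, w a * m q a) :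
    ∃ ν ∈ stdSimplex ℝ H, ∀ a, c ≤ ∑ q, ν q * m q a := by
  classical
  let Φ : (H → ℝ) →ₗ[ℝ] (X → ℝ) := Fintype.linearCombination ℝ m
  have hΦ : ∀ ν a, Φ ν a = ∑ q, ν q * m q a := fun ν a => by
    simp [Φ, Fintype.linearCombination_apply]
  let t : Set (X → ℝ) := Set.Ici fun _ => c
  by_contra! hcon
  have hdisj : Disjoint (Φ '' stdSimplex ℝ H) t := by
    rw [Set.disjoint_left]
    rintro _ ⟨ν, hν, rfl⟩ ht
    obtain ⟨a, ha⟩ := hcon ν hν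
    have := ht a
    rw [hΦ] at this
    exact absurd this (not_le.2 ha)
  obtain ⟨f, u, v, hfu, huv, hvf⟩ := geometric_hahn_banach_compact_closed
    ((convex_stdSimplex ℝ H).linear_image Φ)
    ((isCompact_stdSimplex ℝ H).image Φ.continuous_of_finiteDimensional)
    (convex_Ici _) isClosed_Ici hdisj
  let g : X → ℝ := fun a => f (Pi.single a 1)
  have hf : ∀ x, f x = ∑ a, x a * g a := by
    intro x
    conv_lhs => rw [← Finset.univ_sum_single x]
    rw [map_sum]
    refine Finset.sum_congr rfl fun a _ => ?_
    rw [← smul_eq_mul, ← map_smul]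
    congr 1
    ext b
    by_cases hb : b = a
    · subst hb; simp
    · simp [hb]
  have hg : ∀ a, 0 ≤ g a := by
    intro a
    by_contra! hneg
    let s := (v - f fun _ => c) / g a
    have hs : 0 ≤ s := div_nonneg_of_nonpos
      (sub_nonpos.2 (hvf _ (Set.mem_Ici.2 le_rfl)).le) hneg.le
    have h1 := hvf ((fun _ => c) + s • Pi.single a 1) (by
      intro b
      by_cases hb : b = a
      · subst hb; simpa using hs
      · simp [hb])
    rw [map_add, map_smul, smul_eq_mul] at h1
    have h2 : s * f (Pi.single a 1) = v - f fun _ => c := div_mul_cancel₀ _ hneg.ne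
    linarith
  obtain ⟨q₀, -⟩ := h _ (single_mem_stdSimplex ℝ (Classical.arbitrary X))
  have hpure : ∀ q, f (m q) < u := by
    intro q
    refine hfu _ ⟨Pi.single q 1, single_mem_stdSimplex ℝ q, ?_⟩
    ext a
    simp [hΦ, Pi.single_apply]
  have hc : v < f fun _ => c := hvf _ (Set.mem_Ici.2 le_rfl)
  have hsum : 0 < ∑ a, g a := by
    refine lt_of_le_of_ne (Finset.sum_nonneg fun a _ => hg a) fun h0 => ?_
    have hg0 : ∀ a, g a = 0 := fun a =>
      (Finset.sum_eq_zero_iff_of_nonneg fun a _ => hg a).1 h0.symm a (Finset.mem_univ _)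
    have h1 := hpure q₀
    simp only [hf, hg0, mul_zero, Finset.sum_const_zero] at h1 hc
    linarith
  obtain ⟨q, hq⟩ := h (fun a => g a / ∑ b, g b)
    ⟨fun a => div_nonneg (hg a) hsum.le, by rw [← Finset.sum_div, div_self hsum.ne']⟩
  have h1 := hpure q
  rw [hf] at h1 hc
  have h2 : ∑ a, g a / (∑ b, g b) * m q a = (∑ a, m q a * g a) / ∑ b, g b := by
    rw [Finset.sum_div]
    exact Finset.sum_congr rfl fun a _ => by ring
  rw [h2, le_div_iff₀ hsum, Finset.mul_sum] at hq
  linarith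

theorem exists_fin_subset_range {X : Type*} [Nonempty X] (W : Finset X) {r : ℕ}
    (hW : W.card ≤ r) : ∃ f : Fin r → X, ∀ x ∈ W, ∃ i, f i = x := by
  classical
  refine ⟨fun i => if h : i.1 < W.card then (W.equivFin.symm ⟨i, h⟩).1
    else Classical.arbitrary X, fun x hx => ?_⟩
  refine ⟨⟨W.equivFin ⟨x, hx⟩, (W.equivFin ⟨x, hx⟩).2.trans_le hW⟩, ?_⟩
  simp

/-- **Sample compression for classes of finite VC dimension.** Every member of the class is
the majority vote of boundedly many members, each of which is isolated in the class by
boundedly many points. -/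
theorem exists_majority_of_isolated (d : ℕ) : ∃ k T : ℕ, ∀ (X Y : Type u) [Finite X] [Finite Y]
    [Nonempty X] (R : X → Y → Prop), ¬ RelShatters R d → ∀ p : Y,
      ∃ (q : Fin T → Y) (c : Fin T → Fin k → X),
        (∀ t y, (∀ j, R (c t j) y ↔ R (c t j) (q t)) → ∀ x, R x y ↔ R x (q t)) ∧
        ∀ x, R x p ↔ T < 2 * {t | R x (q t)}.ncard := by
  classical
  obtain ⟨n, hn, hnet⟩ := exists_approximation.{u} d (ε := 1 / 3) (by norm_num)
  obtain ⟨r, hteach⟩ := exists_teaching_set.{u} d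
  obtain ⟨T, hT, hvote⟩ := exists_approximation.{u} (2 ^ d) (ε := 1 / 12) (by norm_num)
  refine ⟨n + r, T, fun X Y _ _ _ R hR p => ?_⟩
  have := Fintype.ofFinite X
  let H := {q : Y // ∃ c : Fin (n + r) → X,
    ∀ y, (∀ j, R (c j) y ↔ R (c j) q) → ∀ x, R x y ↔ R x q}
  have := Fintype.ofFinite H
  have hgood : ∀ w ∈ stdSimplex ℝ X, ∃ q : H,
      2 / 3 ≤ ∑ a, w a * truthValue (R a q.1 ↔ R a p) := by
    intro w hw
    obtain ⟨x, hx⟩ := hnet X Y (fun a y => R a y ↔ ¬ R a p)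
      (fun h => hR h.of_xor) w hw
    have : Nonempty {y // ∀ i, R (x i) y ↔ R (x i) p} := ⟨⟨p, fun _ => Iff.rfl⟩⟩
    obtain ⟨q, W, hW, hq⟩ := hteach X {y // ∀ i, R (x i) y ↔ R (x i) p} (fun a y => R a y.1)
      (fun ⟨z, hz⟩ => hR ⟨z, fun s => let ⟨y, hy⟩ := hz s; ⟨y.1, hy⟩⟩)
    obtain ⟨f, hf⟩ := exists_fin_subset_range W hW
    refine ⟨⟨q.1, Fin.append x f, fun y hy => ?_⟩, ?_⟩
    · refine hq ⟨y, fun i => ?_⟩ fun a ha => ?_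
      · have := hy (Fin.castAdd r i)
        rw [Fin.append_left] at this
        exact this.trans (q.2 i)
      · obtain ⟨j, rfl⟩ := hf a ha
        simpa using hy (Fin.natAdd n j)
    · have h1 := hx q.1
      have h2 : ∀ i, truthValue (R (x i) q.1 ↔ ¬ R (x i) p) = 0 := by
        intro i
        have := q.2 i
        unfold truthValue
        rw [if_neg (by tauto)]
      have h3 : ∀ a, truthValue (R a q.1 ↔ R a p) =
          1 - truthValue (R a q.1 ↔ ¬ R a p) := by
        intro a
        rw [← truthValue_not]
        congr 1
        exact propext (by tauto)
      simp only [h2, Finset.sum_const_zero, zero_div, zero_add] at h1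
      simp only [h3, mul_sub, mul_one, Finset.sum_sub_distrib, hw.2]
      linarith
  obtain ⟨ν, hν, hνc⟩ := exists_mixed_strategy
    (fun (q : H) a => truthValue (R a q.1 ↔ R a p)) (2 / 3) hgood
  have hdual : ¬ RelShatters (fun (q : H) a => R a q.1 ↔ R a p) (2 ^ d) := by
    intro h
    obtain ⟨x, hx⟩ := RelShatters.of_xor (R := fun x (q : H) => R x q.1) h.flip
    exact hR ⟨x, fun s => let ⟨y, hy⟩ := hx s; ⟨y.1, hy⟩⟩
  obtain ⟨q, hq⟩ := hvote H X _ hdual ν hν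
  choose c hc using fun q : H => q.2
  refine ⟨fun t => (q t).1, fun t => c (q t), fun t => hc (q t), fun x => ?_⟩
  have hT' : (0 : ℝ) < T := by exact_mod_cast hT
  have h1 : (7 / 12 : ℝ) * T ≤ ({t | R x (q t).1 ↔ R x p} : Set (Fin T)).ncard := by
    have h2 := (hνc x).trans (hq x)
    have h3 : ∑ i, truthValue (R x (q i).1 ↔ R x p) =
        ({t | R x (q t).1 ↔ R x p} : Set (Fin T)).ncard := by
      rw [Set.ncard_eq_toFinset_card', Set.toFinset_ofPred, ← Finset.sum_boole]
      refine Finset.sum_congr rfl fun i _ => ?_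
      unfold truthValue
      congr
    rw [h3] at h2
    rw [← le_div_iff₀ hT']
    linarith
  have h4 : T < 2 * ({t | R x (q t).1 ↔ R x p} : Set (Fin T)).ncard := by
    have : (T : ℝ) < 2 * ({t | R x (q t).1 ↔ R x p} : Set (Fin T)).ncard := by linarith
    exact_mod_cast this
  by_cases hp : R x p
  · simpa [hp] using h4
  · have h5 := Set.ncard_add_ncard_compl {t | R x (q t).1}
    have h6 : ({t | R x (q t).1} : Set (Fin T))ᶜ = {t | R x (q t).1 ↔ R x p} := by
      ext t; simp [hp]
    rw [h6] at h5
    simp only [Nat.card_eq_fintype_card, Fintype.card_fin] at h5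
    simp only [hp, false_iff]
    omega

section Formulas

variable {L : FirstOrder.Language.{u, v}} {nx ny : ℕ}

/-- The relation on `M^x × M^y` defined by `φ`. -/
def formulaRel (φ : L.Formula (Fin nx ⊕ Fin ny)) (M : Type*) [L.Structure M] :
    (Fin nx → M) → (Fin ny → M) → Prop :=
  fun b a => φ.Realize (Sum.elim b a)

/-- The sentence saying that `φ` shatters some `n`-tuple. -/
noncomputable def shatterSentence (φ : L.Formula (Fin nx ⊕ Fin ny)) (n : ℕ) : L.Sentence :=
  Formula.iExs (Fin n × Fin nx) <| Formula.iInf fun s : Set (Fin n) =>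
    Formula.iExs (Fin ny) <| Formula.iInf fun i : Fin n =>
      open Classical in
      (φ.relabel (Sum.map (fun j => (Sum.inr (i, j) : Empty ⊕ (Fin n × Fin nx))) id)).iff
        (if i ∈ s then ⊤ else ⊥)

theorem realize_shatterSentence (φ : L.Formula (Fin nx ⊕ Fin ny)) (n : ℕ) (M : Type*)
    [L.Structure M] : M ⊨ shatterSentence φ n ↔ RelShatters (formulaRel φ M) n := by
  classical
  have hite : ∀ (p : Prop) [Decidable p] (w : (Empty ⊕ (Fin n × Fin nx)) ⊕ Fin ny → M),
      (if p then (⊤ : L.Formula _) else ⊥).Realize w ↔ p := by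
    intro p _ w
    split_ifs with h <;> simp [h, Formula.Realize]
  have hval : ∀ (v : Empty → M) (x : Fin n × Fin nx → M) (y : Fin ny → M) (i : Fin n),
      Sum.elim (Sum.elim v x) y ∘ Sum.map (fun j => Sum.inr (i, j)) id =
        Sum.elim (fun j => x (i, j)) y := by
    intro v x y i
    ext j
    rcases j with j | j <;> rfl
  simp only [Sentence.Realize, shatterSentence, Formula.realize_iExs, Formula.realize_iInf,
    Formula.realize_iff, hite, Formula.realize_relabel, hval, RelShatters, formulaRel]
  exact ⟨fun ⟨x, hx⟩ => ⟨fun i j => x (i, j), hx⟩, fun ⟨x, hx⟩ => ⟨fun p => x p.1 p.2, hx⟩⟩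

theorem RelShatters.mono {X Y : Type*} {R : X → Y → Prop} {m n : ℕ} (hmn : m ≤ n)
    (h : RelShatters R n) : RelShatters R m := by
  obtain ⟨x, hx⟩ := h
  refine ⟨fun i => x (Fin.castLE hmn i), fun s => ?_⟩
  obtain ⟨y, hy⟩ := hx (Fin.castLE hmn '' s)
  exact ⟨y, fun i => (hy _).trans (Fin.castLE_injective hmn).mem_set_image⟩

theorem VCDimLE.not_relShatters {φ : L.Formula (Fin nx ⊕ Fin ny)} {M : Type (max u v)}
    [L.Structure M] {n : ℕ} (h : VCDimLE (defFamily φ M) n) :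
    ¬ RelShatters (formulaRel φ M) (n + 1) := by
  classical
  rintro ⟨x, hx⟩
  have hcard := h (Finset.univ.image x) (fun S hS => by
    obtain ⟨y, hy⟩ := hx {i | x i ∈ S}
    refine ⟨_, ⟨y, rfl⟩, ?_⟩
    ext b
    constructor
    · rintro ⟨hb, hb'⟩
      obtain ⟨i, -, rfl⟩ := Finset.mem_image.1 (Finset.mem_coe.1 hb')
      exact (hy i).1 hb
    · intro hb
      obtain ⟨i, -, rfl⟩ := Finset.mem_image.1 (Finset.mem_coe.1 (hS hb))
      exact ⟨(hy i).2 hb, hS hb⟩)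
  rw [Finset.card_image_of_injective _ (RelShatters.injective hx)] at hcard
  simp at hcard

theorem vcDimLE_of_not_relShatters {φ : L.Formula (Fin nx ⊕ Fin ny)} {M : Type (max u v)}
    [L.Structure M] {n : ℕ} (h : ¬ RelShatters (formulaRel φ M) n) :
    VCDimLE (defFamily φ M) n := by
  intro B hB
  by_contra! hlt
  refine h (RelShatters.mono hlt.le ⟨fun i => (B.equivFin.symm i).1, fun s => ?_⟩)
  obtain ⟨_, ⟨y, rfl⟩, hy⟩ := hB ((fun i => (B.equivFin.symm i).1) '' s) (by
    rintro _ ⟨i, -, rfl⟩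
    exact (B.equivFin.symm i).2)
  refine ⟨y, fun i => ?_⟩
  have h1 := congrArg (fun S => (B.equivFin.symm i).1 ∈ S) hy
  have hinj : Function.Injective fun i => (B.equivFin.symm i).1 :=
    Subtype.val_injective.comp B.equivFin.symm.injective
  rw [← hinj.mem_set_image (s := s)]
  simpa [formulaRel] using h1

/-- By compactness, a formula which is NIP in `T` has a bound on its VC dimension which is
uniform over all models of `T`. -/
theorem FormulaNIP.exists_uniform {T : L.Theory} {φ : L.Formula (Fin nx ⊕ Fin ny)}
    (h : FormulaNIP T φ) : ∃ d : ℕ, ∀ (M : Type (max u v)) [L.Structure M] [Nonempty M],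
      M ⊨ T → ¬ RelShatters (formulaRel φ M) d := by
  by_contra! hcon
  have hsat : Theory.IsSatisfiable (⋃ n, (T ∪ {shatterSentence φ n})) := by
    rw [Theory.isSatisfiable_iUnion_iff_isSatisfiable_iUnion_finset]
    intro s
    obtain ⟨M, _, _, hM, hsh⟩ := hcon (s.sup id)
    have hmodel : M ⊨ ⋃ i ∈ s, (T ∪ {shatterSentence φ i}) := by
      rw [Theory.model_iff]
      intro θ hθ
      simp only [Set.mem_iUnion] at hθ
      obtain ⟨i, hi, hθ | rfl⟩ := hθ
      · exact Theory.realize_sentence_of_mem T hθ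
      · exact (realize_shatterSentence φ i M).2 (hsh.mono (Finset.le_sup (f := id) hi))
    exact Theory.Model.isSatisfiable M
  obtain ⟨M⟩ := hsat
  have hM : ∀ n, M ⊨ T ∪ {shatterSentence φ n} := fun n =>
    Theory.Model.mono M.is_model (Set.subset_iUnion (fun n => T ∪ {shatterSentence φ n}) n)
  obtain ⟨n, hn⟩ := h M (Theory.Model.mono (hM 0) Set.subset_union_left)
  refine hn.not_relShatters ((realize_shatterSentence φ (n + 1) M).1 ?_)
  exact (hM (n + 1)).realize_of_mem _ (Or.inr rfl)

/-- The formula `ψ(y; c, e, e')` saying that the majority of `t < T` satisfy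
`∃ x, φ(x, y) ∧ ⋀ j, (φ(x, c t j) ↔ e t j = e' t j)`. -/
noncomputable def majorityFormula (φ : L.Formula (Fin nx ⊕ Fin ny)) (T k : ℕ) :
    L.Formula (Fin ny ⊕ ((Fin T × Fin k × Fin 3) × Fin ny)) :=
  Formula.iSup fun S : {S : Set (Fin T) // T < 2 * S.ncard} => Formula.iInf fun t : S.1 =>
    Formula.iExs (Fin nx) <|
      (Formula.iInf fun j : Fin k =>
        (φ.relabel (Sum.elim Sum.inr fun i => Sum.inl (Sum.inr ((t.1, j, 0), i)))).iff
          (Formula.iInf fun i : Fin ny =>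
            Term.equal (Term.var (Sum.inl (Sum.inr ((t.1, j, 1), i))))
              (Term.var (Sum.inl (Sum.inr ((t.1, j, 2), i)))))) ⊓
      φ.relabel (Sum.elim Sum.inr fun i => Sum.inl (Sum.inl i))

theorem realize_majorityFormula (φ : L.Formula (Fin nx ⊕ Fin ny)) (T k : ℕ) {M : Type*}
    [L.Structure M] (a : Fin ny → M) (c : Fin T × Fin k × Fin 3 → Fin ny → M) :
    (majorityFormula φ T k).Realize (Sum.elim a fun iz => c iz.1 iz.2) ↔
      T < 2 * {t | ∃ b, (∀ j, formulaRel φ M b (c (t, j, 0)) ↔ c (t, j, 1) = c (t, j, 2)) ∧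
        formulaRel φ M b a}.ncard := by
  have hval : ∀ (b : Fin nx → M) t j, Sum.elim (Sum.elim a fun iz => c iz.1 iz.2) b ∘
      (Sum.elim Sum.inr fun i => Sum.inl (Sum.inr ((t, j, 0), i))) =
        Sum.elim b (c (t, j, 0)) := by
    intro b t j
    ext i
    rcases i with i | i <;> rfl
  have hval' : ∀ b : Fin nx → M, Sum.elim (Sum.elim a
      fun iz : (Fin T × Fin k × Fin 3) × Fin ny => c iz.1 iz.2) b ∘
      (Sum.elim Sum.inr fun i => Sum.inl (Sum.inl i)) = Sum.elim b a := by
    intro b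
    ext i
    rcases i with i | i <;> rfl
  simp only [majorityFormula, Formula.realize_iSup, Formula.realize_iInf, Formula.realize_iExs,
    Formula.realize_inf, Formula.realize_iff, Formula.realize_relabel, hval, hval',
    Formula.realize_equal, Term.realize_var, Sum.elim_inl, Sum.elim_inr, formulaRel, funext_iff]
  constructor
  · rintro ⟨S, hS⟩
    refine S.2.trans_le (Nat.mul_le_mul_left 2 (Set.ncard_le_ncard (fun t ht => hS ⟨t, ht⟩)
      (Set.toFinite _)))
  · intro h
    exact ⟨⟨_, h⟩, fun t => t.2⟩

theorem FormulaNIP.udtfs {T : L.Theory} {φ : L.Formula (Fin nx ⊕ Fin ny)}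
    (h : FormulaNIP T φ) : UDTFS T φ := by
  classical
  obtain ⟨d, hd⟩ := h.exists_uniform
  obtain ⟨k, N, hmaj⟩ := exists_majority_of_isolated.{max u v} (2 ^ d)
  let e : (Fin N × Fin k × Fin 3) ≃ Fin (Fintype.card (Fin N × Fin k × Fin 3)) :=
    Fintype.equivFin _
  refine ⟨_, (majorityFormula φ N k).relabel (Sum.map id (Prod.map e id)), ?_⟩
  intro M _ _ hM A hA hA2 p hp
  have := hA.to_subtype
  obtain ⟨a₀, ha₀, a₁, ha₁, hne⟩ := (Set.one_lt_ncard hA).1 hA2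
  have : Nonempty A := ⟨⟨a₀, ha₀⟩⟩
  let Y := Set.range fun (b : Fin nx → M) => {a : A | formulaRel φ M b a.1}
  have hreal : ∀ y : Y, ∃ b, ∀ a : A, a ∈ y.1 ↔ formulaRel φ M b a.1 := by
    rintro ⟨_, b, rfl⟩
    exact ⟨b, fun a => Iff.rfl⟩
  choose real hreal using hreal
  obtain ⟨b, hb⟩ := hp.2 hA.toFinset (by simp)
  have hb' : ∀ a ∈ A, (formulaRel φ M b a ↔ a ∈ p) := fun a ha => hb a (by simpa using ha)
  let pY : Y := ⟨_, b, rfl⟩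
  have hsh : ¬ RelShatters (fun (a : A) (y : Y) => a ∈ y.1) (2 ^ d) := by
    intro hs
    obtain ⟨x, hx⟩ := hs.flip
    refine hd M hM ⟨fun i => real (x i), fun s => ?_⟩
    obtain ⟨a, ha⟩ := hx s
    exact ⟨a.1, fun i => (hreal (x i) a).symm.trans (ha i)⟩
  obtain ⟨q, c, hqc, hvote⟩ := hmaj A Y (fun a y => a ∈ y.1) hsh pY
  let code : Fin N × Fin k × Fin 3 → A := fun z =>
    ![c z.1 z.2.1, ⟨a₀, ha₀⟩,
      if c z.1 z.2.1 ∈ (q z.1).1 then ⟨a₀, ha₀⟩ else ⟨a₁, ha₁⟩] z.2.2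
  refine ⟨fun i => (code (e.symm i)).1, fun i => (code (e.symm i)).2, fun a ha => ?_⟩
  have hval : (Sum.elim a fun iz : Fin _ × Fin ny => (code (e.symm iz.1)).1 iz.2) ∘
      Sum.map id (Prod.map e id) = Sum.elim a fun iz => (code iz.1).1 iz.2 := by
    ext i
    rcases i with i | ⟨i, j⟩ <;> simp
  rw [Formula.realize_relabel, hval, realize_majorityFormula φ N k a fun z => (code z).1,
    ← hb' a ha]
  have hv := hvote ⟨a, ha⟩
  have hpY : (⟨a, ha⟩ : A) ∈ pY.1 ↔ formulaRel φ M b a := Iff.rfl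
  rw [← hpY, hv]
  suffices hset : ∀ t, (∃ b, (∀ j, formulaRel φ M b (code (t, j, 0)).1 ↔
      (code (t, j, 1)).1 = (code (t, j, 2)).1) ∧ formulaRel φ M b a) ↔
      (⟨a, ha⟩ : A) ∈ (q t).1 by
    simp only [hset]
  intro t
  have hcode : ∀ j, (code (t, j, 1)).1 = (code (t, j, 2)).1 ↔ c t j ∈ (q t).1 := by
    intro j
    by_cases hj : c t j ∈ (q t).1 <;> simp [code, hj, hne]
  simp only [hcode]
  constructor
  · rintro ⟨b', hb', hba⟩
    exact (hqc t ⟨_, b', rfl⟩ hb' ⟨a, ha⟩).1 hba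
  · intro hat
    exact ⟨real (q t), fun j => (hreal (q t) (c t j)).symm, (hreal (q t) ⟨a, ha⟩).1 hat⟩

theorem UDTFS.formulaNIP {T : L.Theory} {φ : L.Formula (Fin nx ⊕ Fin ny)}
    (h : UDTFS T φ) : FormulaNIP T φ := by
  obtain ⟨k, ψ, hψ⟩ := h
  intro M _ _ hM
  obtain ⟨N, hN2, hN⟩ : ∃ N : ℕ, 2 ≤ N ∧ N ^ k < 2 ^ N := by
    have h1 := (tendsto_pow_const_div_const_pow_of_one_lt k one_lt_two).eventually_lt_const
      one_pos
    obtain ⟨N, hN, hN2⟩ := (h1.and (Filter.eventually_ge_atTop 2)).exists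
    rw [div_lt_one (by positivity)] at hN
    exact ⟨N, hN2, by exact_mod_cast hN⟩
  refine ⟨2 ^ N, vcDimLE_of_not_relShatters fun hsh => ?_⟩
  obtain ⟨a, ha⟩ := hsh.flip
  have hinj : Function.Injective a := RelShatters.injective (R := fun y x => formulaRel φ M x y) ha
  have hdef : ∀ s : Set (Fin N), ∃ c : Fin k → Fin N,
      ∀ i, ψ.Realize (Sum.elim (a i) fun iz => a (c iz.1) iz.2) ↔ i ∈ s := by
    intro s
    obtain ⟨b, hb⟩ := ha s
    obtain ⟨c, hcA, hc⟩ := hψ M hM (Set.range a) (Set.finite_range a)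
      (by rw [Set.ncard_range_of_injective hinj]; simpa using hN2) (a '' s)
      ⟨Set.image_subset_range _ _, fun A₀ hA₀ => ⟨b, fun y hy => by
        obtain ⟨i, rfl⟩ := hA₀ hy
        exact (hb i).trans hinj.mem_set_image.symm⟩⟩
    choose c' hc' using hcA
    refine ⟨c', fun i => ?_⟩
    simp only [hc']
    exact (hc (a i) ⟨i, rfl⟩).trans hinj.mem_set_image
  choose c hc using hdef
  have hcinj : Function.Injective c := by
    intro s s' hss
    ext i
    rw [← hc s i, ← hc s' i, hss]
  have := Fintype.card_le_of_injective c hcinj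
  simp at this
  omega

end Formulas

/-- **Main Theorem** (Eshel–Kaplan): a formula `φ(x,y)` is NIP in `T` if and only if it
has uniform definability of types over finite sets in `T`. -/
theorem formulaNIP_iff_udtfs {L : FirstOrder.Language.{u, v}} {nx ny : ℕ} (T : L.Theory)
    (φ : L.Formula (Fin nx ⊕ Fin ny)) :
    FormulaNIP T φ ↔ UDTFS T φ := by
  exact ⟨FormulaNIP.udtfs, UDTFS.formulaNIP⟩
end

section
/- Let L be a first-order language, T an L-theory and φ(x,y) an L-formula with its free variables partitioned into tuples x and y. Suppose ψ(y,z) is an L-formula, with z a finite tuple of copies of y, which uniformly defines φ-types over finite sets in T: for every model M ⊨ T, every finite A ⊆ M^y with |A| ≥ 2 and every φ-type p over A, there is c ∈ A^z such that ψ(y,c) defines p. Then for every model M ⊨ T and every finite A ⊆ M^y with |A| ≥ 2, the number of φ-types over A is at most |A|^{|z|} (where |z| is the number of copies of y in z); consequently φ is NIP in T. -/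
open FirstOrder Language

universe u v

/-- A `φ`-type over `A` is determined by the tuple of parameters of a `ψ`-definition of it, so
uniformly definable `φ`-types over a finite set are polynomially many. -/
theorem ncard_isPhiType_le {L : FirstOrder.Language.{u, v}} {α β : Type*} {k : ℕ}
    {M : Type (max u v)} [L.Structure M] (φ : L.Formula (α ⊕ β))
    (ψ : L.Formula (β ⊕ (Fin k × β))) {A : Set (β → M)} (hA : A.Finite)
    (h : ∀ p : Set (β → M), IsPhiType φ A p →
      ∃ c : Fin k → β → M, (∀ i, c i ∈ A) ∧ DefinesType ψ c A p) :
    Set.ncard {p : Set (β → M) | IsPhiType φ A p} ≤ A.ncard ^ k := by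
  have : Finite A := hA
  let f : (Fin k → A) → Set (β → M) := fun c =>
    {a | a ∈ A ∧ ψ.Realize (Sum.elim a fun iz => (c iz.1 : β → M) iz.2)}
  have hsub : {p : Set (β → M) | IsPhiType φ A p} ⊆ f '' Set.univ := by
    intro p hp
    obtain ⟨c, hc, hdef⟩ := h p hp
    refine ⟨fun i => ⟨c i, hc i⟩, trivial, Set.ext fun a => ?_⟩
    exact ⟨fun ha => (hdef a ha.1).1 ha.2, fun ha => ⟨hp.1 ha, (hdef a (hp.1 ha)).2 ha⟩⟩
  calc Set.ncard {p : Set (β → M) | IsPhiType φ A p}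
      ≤ (f '' Set.univ).ncard := Set.ncard_le_ncard hsub (Set.toFinite _)
    _ ≤ (Set.univ : Set (Fin k → A)).ncard := Set.ncard_image_le (Set.toFinite _)
    _ = A.ncard ^ k := by
      rw [Set.ncard_univ, Nat.card_fun, Nat.card_coe_set_eq, Nat.card_fin]

/-- Exponential growth beats polynomial growth, at some argument that is at least `2`. -/
theorem exists_two_le_pow_lt_two_pow (k : ℕ) : ∃ m : ℕ, 2 ≤ m ∧ m ^ k < 2 ^ m := by
  have h := (tendsto_pow_const_div_const_pow_of_one_lt k (one_lt_two (α := ℝ))).eventually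
    (gt_mem_nhds one_pos)
  obtain ⟨m, hm, hm2⟩ := (h.and (Filter.eventually_ge_atTop 2)).exists
  refine ⟨m, hm2, ?_⟩
  rw [div_lt_one (by positivity)] at hm
  exact_mod_cast hm

/-- If the instances of `φ` shatter a set of at least `2 ^ m` elements, then there is a set of `m`
parameters all of whose subsets are `φ`-types (dual shattering). -/
theorem exists_isPhiType_of_setShatters {L : FirstOrder.Language.{u, v}} {α β : Type*}
    {M : Type (max u v)} [L.Structure M] (φ : L.Formula (α ⊕ β)) {m : ℕ}
    {B : Finset (α → M)} (hB : SetShatters (defFamily φ M) ↑B) (hm : 2 ^ m ≤ B.card) :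
    ∃ A : Set (β → M), A.Finite ∧ A.ncard = m ∧ ∀ p ⊆ A, IsPhiType φ A p := by
  obtain ⟨e⟩ : Nonempty (Set (Fin m) ↪ B) := by
    classical
    apply Function.Embedding.nonempty_of_card_le
    simpa using hm
  have key : ∀ i : Fin m, ∃ a : β → M, ∀ s : Set (Fin m),
      φ.Realize (Sum.elim (e s : α → M) a) ↔ i ∈ s := by
    intro i
    obtain ⟨_, ⟨a, rfl⟩, ha⟩ := hB {b | ∃ s, i ∈ s ∧ (e s : α → M) = b} (by
      rintro _ ⟨s, -, rfl⟩
      exact (e s).2)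
    refine ⟨a, fun s => ?_⟩
    have hs := Set.ext_iff.1 ha (e s)
    constructor
    · intro hr
      obtain ⟨t, hit, hts⟩ := hs.1 ⟨hr, (e s).2⟩
      rwa [← e.injective (Subtype.ext hts)]
    · exact fun hi => (hs.2 ⟨s, hi, rfl⟩).1
  choose a ha using key
  have ainj : Function.Injective a := by
    intro i j hij
    have h := (ha j {i}).1 (hij ▸ (ha i {i}).2 rfl)
    exact h.symm
  refine ⟨Set.range a, Set.finite_range a, ?_, fun p hp => ⟨hp, fun A₀ hA₀ => ?_⟩⟩
  · rw [← Set.image_univ, Set.ncard_image_of_injective _ ainj, Set.ncard_univ, Nat.card_fin]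
  · refine ⟨e (a ⁻¹' p), fun x hx => ?_⟩
    obtain ⟨i, rfl⟩ := hA₀ hx
    exact ha i _

/-- If `ψ(y,z)` uniformly defines `φ`-types over finite sets (of size `≥ 2`) in `T`,
then the number of `φ`-types over any such finite set `A` is at most `|A|^|z|`;
consequently `φ` is NIP in `T`. -/
theorem udtfs_type_counting {L : FirstOrder.Language.{u, v}} {nx ny k : ℕ}
    (T : L.Theory) (φ : L.Formula (Fin nx ⊕ Fin ny))
    (ψ : L.Formula (Fin ny ⊕ (Fin k × Fin ny)))
    (hψ : ∀ (M : Type (max u v)) [L.Structure M] [Nonempty M], M ⊨ T →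
      ∀ A : Set (Fin ny → M), A.Finite → 2 ≤ A.ncard →
        ∀ p : Set (Fin ny → M), IsPhiType φ A p →
          ∃ c : Fin k → Fin ny → M, (∀ i, c i ∈ A) ∧ DefinesType ψ c A p) :
    (∀ (M : Type (max u v)) [L.Structure M] [Nonempty M], M ⊨ T →
      ∀ A : Set (Fin ny → M), A.Finite → 2 ≤ A.ncard →
        Set.ncard {p : Set (Fin ny → M) | IsPhiType φ A p} ≤ A.ncard ^ k) ∧
    FormulaNIP T φ := by
  refine ⟨fun M _ _ hM A hA h2 => ncard_isPhiType_le φ ψ hA (hψ M hM A hA h2),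
    fun M _ _ hM => ?_⟩
  obtain ⟨m, hm2, hm⟩ := exists_two_le_pow_lt_two_pow k
  refine ⟨2 ^ m, fun B hB => ?_⟩
  by_contra! hcard
  obtain ⟨A, hA, rfl, hp⟩ := exists_isPhiType_of_setShatters φ hB hcard.le
  have hle := ncard_isPhiType_le φ ψ hA (hψ M hM A hA hm2)
  have heq : {p : Set (Fin ny → M) | IsPhiType φ A p} = 𝒫 A :=
    Set.ext fun p => ⟨fun h => h.1, hp p⟩
  rw [heq, Set.ncard_powerset A hA] at hle
  omega
end

section
/- Let L be a first-order language, T an L-theory and φ(x,y) an L-formula with its free variables partitioned into tuples x and y. Then the following are equivalent: (i) for every model M ⊨ T, the family {φ(M,a) : a ∈ M^y} of subsets of M^x has finite VC dimension; (ii) there exists a single n < ω such that for every model M ⊨ T, the VC dimension of the family {φ(M,a) : a ∈ M^y} is at most n. -/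
open FirstOrder Language

universe u v

theorem VCDimLE.mono {X : Type*} {F : Set (Set X)} {m n : ℕ} (h : VCDimLE F m) (hmn : m ≤ n) :
    VCDimLE F n :=
  fun B hB => (h B hB).trans hmn

/-- A set family has VC dimension greater than `n` iff there are `n + 1` points and members of the
family, indexed by the sets of indices, whose membership relation is the standard one. -/
theorem not_vcDimLE_iff {X : Type*} {F : Set (Set X)} {n : ℕ} :
    ¬VCDimLE F n ↔ ∃ b : Fin (n + 1) → X, ∀ S : Set (Fin (n + 1)), ∃ f ∈ F,
      ∀ i, b i ∈ f ↔ i ∈ S := by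
  classical
  constructor
  · intro h
    simp only [VCDimLE, not_forall, not_le] at h
    obtain ⟨B, hB, hn⟩ := h
    obtain ⟨e⟩ : Nonempty (Fin (n + 1) ↪ B) :=
      Function.Embedding.nonempty_of_card_le (by simpa using hn)
    refine ⟨fun i => e i, fun S => ?_⟩
    obtain ⟨f, hf, hfB⟩ := hB ((fun i => (e i : X)) '' S) (by
      rintro _ ⟨i, -, rfl⟩
      exact (e i).2)
    have hinj : Function.Injective fun i => (e i : X) := Subtype.val_injective.comp e.injective
    refine ⟨f, hf, fun i => ?_⟩
    rw [← hinj.mem_set_image, ← hfB]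
    exact ⟨fun h => ⟨h, (e i).2⟩, And.left⟩
  · rintro ⟨b, hb⟩ h
    have hinj : Function.Injective b := by
      intro i j hij
      obtain ⟨f, -, hf⟩ := hb {j}
      exact (hf i).1 (hij ▸ (hf j).2 rfl)
    have hcard := h (Finset.univ.map ⟨b, hinj⟩) (by
      intro S hS
      obtain ⟨f, hf, hfS⟩ := hb (b ⁻¹' S)
      refine ⟨f, hf, Set.ext fun x => ⟨?_, fun hx => ?_⟩⟩
      · rintro ⟨hxf, hxB⟩
        obtain ⟨i, rfl⟩ : ∃ i, b i = x := by simpa using hxB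
        exact (hfS i).1 hxf
      · obtain ⟨i, rfl⟩ : ∃ i, b i = x := by simpa using hS hx
        exact ⟨(hfS i).2 hx, hS hx⟩)
    simp at hcard

theorem not_vcDimLE_defFamily_iff {L : FirstOrder.Language.{u, v}} {α β : Type*}
    {φ : L.Formula (α ⊕ β)} {M : Type (max u v)} [L.Structure M] {n : ℕ} :
    ¬VCDimLE (defFamily φ M) n ↔ ∃ (b : Fin (n + 1) → α → M) (a : Set (Fin (n + 1)) → β → M),
      ∀ S i, φ.Realize (Sum.elim (b i) (a S)) ↔ i ∈ S := by
  rw [not_vcDimLE_iff]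
  refine exists_congr fun b => ⟨fun h => ?_, ?_⟩
  · choose f hf hb using h
    choose a ha using hf
    refine ⟨a, fun S i => ?_⟩
    rw [← hb S i, ha S, Set.mem_ofPred_eq]
  · rintro ⟨a, ha⟩ S
    exact ⟨_, ⟨a S, rfl⟩, ha S⟩

/-- If almost all factors of an ultraproduct have VC dimension greater than `n` for the instances
of `φ`, then so does the ultraproduct. -/
theorem not_vcDimLE_defFamily_ultraproduct {L : FirstOrder.Language.{u, v}} {α β : Type*}
    {φ : L.Formula (α ⊕ β)} (U : Ultrafilter ℕ) (M : ℕ → Type (max u v))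
    [∀ k, L.Structure (M k)] [∀ k, Nonempty (M k)] {n : ℕ}
    (h : ∀ᶠ k in U, ¬VCDimLE (defFamily φ (M k)) n) :
    ¬VCDimLE (defFamily φ ((U : Filter ℕ).Product M)) n := by
  have hM : ∀ k, ∃ (b : Fin (n + 1) → α → M k) (a : Set (Fin (n + 1)) → β → M k),
      ¬VCDimLE (defFamily φ (M k)) n →
        ∀ S i, φ.Realize (Sum.elim (b i) (a S)) ↔ i ∈ S := by
    intro k
    by_cases hk : VCDimLE (defFamily φ (M k)) n
    · exact ⟨fun _ _ => Classical.arbitrary _, fun _ _ => Classical.arbitrary _,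
        fun h => absurd hk h⟩
    · obtain ⟨b, a, hba⟩ := not_vcDimLE_defFamily_iff.1 hk
      exact ⟨b, a, fun _ => hba⟩
  choose b a hba using hM
  rw [not_vcDimLE_defFamily_iff]
  refine ⟨fun i x => ((fun k => b k i x : ∀ k, M k) : (U : Filter ℕ).Product M),
    fun S y => ((fun k => a k S y : ∀ k, M k) : (U : Filter ℕ).Product M), fun S i => ?_⟩
  have hcast := Ultraproduct.realize_formula_cast (u := U) (M := M) φ
    (Sum.elim (fun x k => b k i x) fun y k => a k S y)
  have helim : ∀ k, (fun z => Sum.elim (fun x k => b k i x) (fun y k => a k S y) z k) =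
      Sum.elim (b k i) (a k S) := fun k => by
    ext (x | y) <;> rfl
  have hprod : (fun z => ((Sum.elim (fun x k => b k i x) (fun y k => a k S y) z : ∀ k, M k) :
      (U : Filter ℕ).Product M)) = Sum.elim
        (fun x => ((fun k => b k i x : ∀ k, M k) : (U : Filter ℕ).Product M))
        (fun y => ((fun k => a k S y : ∀ k, M k) : (U : Filter ℕ).Product M)) := by
    ext (x | y) <;> rfl
  simp only [helim] at hcast
  rw [hprod] at hcast
  exact hcast.trans ((Filter.eventually_congr (h.mono fun k hk => hba k hk S i)).trans
    Filter.eventually_const)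

/-- `φ` is NIP in `T` (every model gives a family of finite VC dimension) if and only if
there is a single uniform bound `n` on the VC dimension across all models of `T`. -/
theorem formulaNIP_iff_uniform_bound {L : FirstOrder.Language.{u, v}} {nx ny : ℕ}
    (T : L.Theory) (φ : L.Formula (Fin nx ⊕ Fin ny)) :
    (∀ (M : Type (max u v)) [L.Structure M] [Nonempty M], M ⊨ T →
      ∃ n : ℕ, VCDimLE (defFamily φ M) n) ↔
    (∃ n : ℕ, ∀ (M : Type (max u v)) [L.Structure M] [Nonempty M], M ⊨ T →
      VCDimLE (defFamily φ M) n) := by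
  refine ⟨fun h => ?_, fun ⟨n, hn⟩ M _ _ hM => ⟨n, hn M hM⟩⟩
  by_contra! hne
  choose M hS hN hT hVC using hne
  have hmodel : (((Filter.hyperfilter ℕ : Ultrafilter ℕ) : Filter ℕ).Product M) ⊨ T :=
    ⟨fun ψ hψ => (Ultraproduct.sentence_realize ψ).2
      (Filter.Eventually.of_forall fun k => (hT k).realize_of_mem ψ hψ)⟩
  obtain ⟨n, hn⟩ := h _ hmodel
  refine not_vcDimLE_defFamily_ultraproduct _ M ?_ hn
  filter_upwards [Nat.hyperfilter_le_atTop (Filter.eventually_ge_atTop n)] with k hk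
  exact fun hle => hVC k (hle.mono hk)
end

section
/- Define t : ℕ → ℕ by t(0) = 0 and t(n) = t(n−1) + 2^n·(n−1) + 1 for n ≥ 1. Then for every n < ω, every finite set X and every nonempty family 𝓕 of subsets of X of VC dimension at most n, there exist F ∈ 𝓕 and X₀ ⊆ X with |X₀| ≤ t(n) such that for all F' ∈ 𝓕: F' = F if and only if F' ∩ X₀ = F ∩ X₀. -/
/-- The recursive bound `t(0) = 0`, `t(n) = t(n-1) + 2^n * (n-1) + 1` for `n ≥ 1`. -/
def tFun : ℕ → ℕ
  | 0 => 0
  | n + 1 => tFun n + 2 ^ (n + 1) * n + 1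

/-- Two sets have the same trace on `Y` iff they agree at every point of `Y`. -/
theorem inter_eq_inter_iff_forall_mem {X : Type*} {f g Y : Set X} :
    f ∩ Y = g ∩ Y ↔ ∀ y ∈ Y, (y ∈ f ↔ y ∈ g) := by
  simp only [Set.ext_iff, Set.mem_inter_iff]
  exact forall_congr' fun x => by tauto

/-- The members of `𝓕` that agree with `F` on `Y`. -/
def agreeingOn {X : Type*} (𝓕 : Set (Set X)) (Y : Finset X) (F : Set X) : Set (Set X) :=
  {f ∈ 𝓕 | ∀ y ∈ Y, (y ∈ f ↔ y ∈ F)}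

theorem SetShatters.mono {X : Type*} {𝓕 𝓖 : Set (Set X)} {B : Set X} (h : SetShatters 𝓕 B)
    (h𝓕𝓖 : 𝓕 ⊆ 𝓖) : SetShatters 𝓖 B := fun S hS =>
  let ⟨f, hf, hfS⟩ := h S hS
  ⟨f, h𝓕𝓖 hf, hfS⟩

theorem SetShatters.exists_agree_on {X : Type*} {𝓕 : Set (Set X)} {B : Set X}
    (h : SetShatters 𝓕 B) (S : Set X) : ∃ f ∈ 𝓕, ∀ x ∈ B, (x ∈ f ↔ x ∈ S) := by
  obtain ⟨f, hf, hfS⟩ := h (S ∩ B) Set.inter_subset_right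
  exact ⟨f, hf, inter_eq_inter_iff_forall_mem.1 hfS⟩

theorem subsingleton_of_vcDimLE_zero {X : Type*} {𝓕 : Set (Set X)} (h : VCDimLE 𝓕 0) :
    𝓕.Subsingleton := by
  intro F hF F' hF'
  by_contra hne
  obtain ⟨x, hx⟩ : ∃ x, ¬(x ∈ F ↔ x ∈ F') := by
    by_contra! hall
    exact hne (Set.ext hall)
  have hcard := h {x} fun S _ => by
    by_cases hS : x ∈ F ↔ x ∈ S
    · refine ⟨F, hF, ?_⟩
      grind
    · refine ⟨F', hF', ?_⟩
      grind
  simp at hcard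

/-- If `𝓕` does not shatter `insert y B`, but the members of `𝓕` agreeing with `F` at `y`
already shatter `B`, then some trace on `B` determines membership of `y`. -/
theorem exists_trace_determining {X : Type*} [DecidableEq X] {𝓕 : Set (Set X)} {F : Set X}
    {B : Finset X} {y : X} (hB : SetShatters {f ∈ 𝓕 | y ∈ f ↔ y ∈ F} (B : Set X))
    (hyB : ¬SetShatters 𝓕 (insert y B : Finset X)) :
    ∃ p ∈ B.powerset, ∀ f ∈ 𝓕, (∀ x ∈ B, (x ∈ f ↔ x ∈ p)) → (y ∈ f ↔ y ∈ F) := by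
  classical
  unfold SetShatters at hyB
  push Not at hyB
  obtain ⟨S, hS, hno⟩ := hyB
  have hno' : ∀ f ∈ 𝓕, (∀ x ∈ B, (x ∈ f ↔ x ∈ S)) → ¬(y ∈ f ↔ y ∈ S) := by
    intro f hf hfB hfy
    apply hno f hf
    rw [← Set.inter_eq_left.2 hS, inter_eq_inter_iff_forall_mem]
    intro x hx
    rcases Finset.mem_insert.1 (Finset.mem_coe.1 hx) with rfl | hx
    exacts [hfy, hfB x hx]
  obtain ⟨g, ⟨hg, hgy⟩, hgS⟩ := hB.exists_agree_on S
  refine ⟨B.filter (· ∈ S), by simp, fun f hf hfp => ?_⟩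
  have hfS := hno' f hf fun x hx => by simpa [hx] using hfp x hx
  have hgS' := hno' g hg hgS
  tauto

/-- A subfamily of `𝓕` cut out by at most `2 ^ (n + 1) * n + 1` points that shatters a set of
size `n + 1` can be shrunk by changing these points. -/
theorem exists_agreeingOn_ssubset {X : Type*} {𝓕 : Set (Set X)} {n : ℕ}
    (hVC : VCDimLE 𝓕 (n + 1)) {Y : Finset X} (hY : Y.card ≤ 2 ^ (n + 1) * n + 1) {F : Set X}
    (hF : F ∈ 𝓕) {B : Finset X} (hB : SetShatters (agreeingOn 𝓕 Y F) (B : Set X))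
    (hcard : B.card = n + 1) :
    ∃ Y' : Finset X, Y'.card ≤ 2 ^ (n + 1) * n + 1 ∧ ∃ F' ∈ 𝓕,
      agreeingOn 𝓕 Y' F' ⊂ agreeingOn 𝓕 Y F := by
  classical
  obtain ⟨z, hz⟩ : B.Nonempty := Finset.card_pos.1 (by omega)
  have hstrict : ∀ Y' : Finset X, z ∈ Y' → ∀ F' : Set X,
      agreeingOn 𝓕 Y' F' ⊆ agreeingOn 𝓕 Y F → agreeingOn 𝓕 Y' F' ⊂ agreeingOn 𝓕 Y F := by
    intro Y' hzY' F' hsub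
    obtain ⟨f, hf, hfB⟩ := hB.exists_agree_on F'ᶜ
    refine ⟨hsub, fun hsup => ?_⟩
    have h₁ := (hsup hf).2 z hzY'
    have h₂ := hfB z hz
    simp only [Set.mem_compl_iff] at h₂
    tauto
  rcases hY.lt_or_eq with hlt | heq
  · refine ⟨insert z Y, (Finset.card_insert_le _ _).trans hlt, F, hF, hstrict _ (by simp) _ ?_⟩
    exact fun f hf => ⟨hf.1, fun y hy => hf.2 y (Finset.mem_insert_of_mem hy)⟩
  have hdet : ∀ y ∈ Y, ∃ p ∈ B.powerset,
      ∀ f ∈ 𝓕, (∀ x ∈ B, (x ∈ f ↔ x ∈ p)) → (y ∈ f ↔ y ∈ F) := by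
    intro y hy
    refine exists_trace_determining (hB.mono fun f hf => ⟨hf.1, hf.2 y hy⟩) fun hsh => ?_
    have hyB : y ∉ B := by
      intro hyB
      obtain ⟨f, hf, hfB⟩ := hB.exists_agree_on Fᶜ
      have h₁ := hf.2 y hy
      have h₂ := hfB y hyB
      simp only [Set.mem_compl_iff] at h₂
      tauto
    have := hVC _ hsh
    rw [Finset.card_insert_of_notMem hyB] at this
    omega
  choose! p hpB hp using hdet
  obtain ⟨q, -, hq⟩ := Finset.exists_lt_card_fiber_of_mul_lt_card_of_maps_to (n := n) hpB
    (by rw [Finset.card_powerset, hcard, heq]; omega)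
  obtain ⟨g, hg, hgq⟩ := hB.exists_agree_on (q : Set X)
  refine ⟨Y.filter (p · ≠ q) ∪ B, ?_, g, hg.1, hstrict _ (by simp [hz]) _ ?_⟩
  · have h₁ := Finset.card_union_le (Y.filter (p · ≠ q)) B
    have h₂ := Finset.card_filter_add_card_filter_not (s := Y) (p · = q)
    simp only [ne_eq] at h₁ ⊢
    omega
  · refine fun f hf => ⟨hf.1, fun y hy => ?_⟩
    by_cases hyq : p y = q
    · refine hp y hy f hf.1 fun x hx => ?_
      rw [hyq]
      exact (hf.2 x (Finset.mem_union_right _ hx)).trans (hgq x hx)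
    · exact (hf.2 y (Finset.mem_union_left _ (by simp [hy, hyq]))).trans (hg.2 y hy)

/-- Fixing the trace on few points suitably lowers the VC dimension. -/
theorem exists_agreeingOn_vcDimLE {X : Type*} [Finite X] {𝓕 : Set (Set X)} {n : ℕ}
    (h𝓕 : 𝓕.Nonempty) (hVC : VCDimLE 𝓕 (n + 1)) :
    ∃ Y : Finset X, Y.card ≤ 2 ^ (n + 1) * n + 1 ∧ ∃ F ∈ 𝓕, VCDimLE (agreeingOn 𝓕 Y F) n := by
  let P : Set (Set (Set X)) := {𝓖 | ∃ Y : Finset X, Y.card ≤ 2 ^ (n + 1) * n + 1 ∧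
    ∃ F ∈ 𝓕, agreeingOn 𝓕 Y F = 𝓖}
  obtain ⟨F₀, hF₀⟩ := h𝓕
  have hP : P.Nonempty := ⟨_, ∅, by simp, F₀, hF₀, rfl⟩
  obtain ⟨_, ⟨Y, hY, F, hF, rfl⟩, hmin⟩ := P.toFinite.exists_minimal hP
  refine ⟨Y, hY, F, hF, fun B hB => ?_⟩
  have hle := hVC B (hB.mono fun f hf => hf.1)
  by_contra! hlt
  obtain ⟨Y', hY', F', hF', hss⟩ :=
    exists_agreeingOn_ssubset hVC hY hF hB (by omega)
  exact hss.2 (hmin ⟨Y', hY', F', hF', rfl⟩ hss.1)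

/-- For every `n`, every finite set `X` and every nonempty family `𝓕` of subsets of `X`
of VC dimension at most `n`, some member `F` of `𝓕` is isolated within `𝓕` by its trace
on a subset `X₀` of `X` of size at most `t(n)`. -/
theorem exists_isolated_of_vcDimLE (n : ℕ) (X : Type*) [Finite X]
    (𝓕 : Set (Set X)) (h𝓕 : 𝓕.Nonempty) (hVC : VCDimLE 𝓕 n) :
    ∃ F ∈ 𝓕, ∃ X₀ : Finset X, X₀.card ≤ tFun n ∧
      ∀ F' ∈ 𝓕, (F' = F ↔ F' ∩ ↑X₀ = F ∩ ↑X₀) := by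
  classical
  induction n generalizing 𝓕 with
  | zero =>
    obtain ⟨F, hF⟩ := h𝓕
    exact ⟨F, hF, ∅, by simp, fun F' hF' => by simp [subsingleton_of_vcDimLE_zero hVC hF' hF]⟩
  | succ n ih =>
    obtain ⟨Y, hY, F₀, hF₀, hVC'⟩ := exists_agreeingOn_vcDimLE h𝓕 hVC
    obtain ⟨F, hF, X₀, hX₀, hiso⟩ := ih (agreeingOn 𝓕 Y F₀) ⟨F₀, hF₀, fun _ _ => Iff.rfl⟩ hVC'
    refine ⟨F, hF.1, X₀ ∪ Y, ?_, fun F' hF' => ⟨fun h => h ▸ rfl, fun h => ?_⟩⟩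
    · have := Finset.card_union_le X₀ Y
      rw [tFun]
      omega
    · rw [inter_eq_inter_iff_forall_mem] at h
      refine (hiso F' ⟨hF', fun y hy => ?_⟩).2 (inter_eq_inter_iff_forall_mem.2 fun x hx => ?_)
      · exact (h y (Finset.mem_union_right _ hy)).trans (hF.2 y hy)
      · exact h x (Finset.mem_union_left _ hx)
end

section
/- Let n ≥ 1, let k = 2^n·(n−1) + 1, let X be a finite set with |X| ≥ k, and let 𝓕 be a nonempty family of subsets of X of VC dimension at most n. For b ⊆ X and c ⊆ b write 𝓕_{b,c} = {F ∈ 𝓕 : F ∩ b = c}. Suppose b ⊆ X with |b| = k and c ⊆ b are chosen so that 𝓕_{b,c} is nonempty and of minimal cardinality among all pairs (b',c') with b' ⊆ X, |b'| = k, c' ⊆ b' and 𝓕_{b',c'} nonempty. Then the VC dimension of 𝓕_{b,c} (as a family of subsets of X) is at most n − 1. -/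
/-- A set shattered by a family with constant trace on `b` is disjoint from `b`. -/
theorem SetShatters.disjoint_of_inter_eq {X : Type*} {𝓕 : Set (Set X)} {A b c : Finset X}
    (hA : SetShatters {F | F ∈ 𝓕 ∧ F ∩ ↑b = ↑c} (A : Set X)) : Disjoint A b := by
  refine Finset.disjoint_left.mpr fun x hxA hxb => ?_
  obtain ⟨F, ⟨-, hFc⟩, hF⟩ := hA ∅ (Set.empty_subset _)
  obtain ⟨G, ⟨-, hGc⟩, hG⟩ := hA ↑A subset_rfl
  have hxG : x ∈ G := (hG.symm ▸ Finset.mem_coe.mpr hxA : x ∈ G ∩ ↑A).1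
  have hxF : x ∈ F ∩ ↑b := by
    rw [hFc, ← hGc]
    exact ⟨hxG, hxb⟩
  exact (hF ▸ (⟨hxF.1, hxA⟩ : x ∈ F ∩ ↑A) : x ∈ (∅ : Set X))

/-- If the members of `𝓕` with trace `c` on `b` shatter `A`, and every trace on `A` is also
attained by a member of `𝓕` disagreeing with `c` at `x ∈ b`, then `𝓕` shatters `insert x A`. -/
theorem SetShatters.insert_of_free {X : Type*} [DecidableEq X] {𝓕 : Set (Set X)}
    {A b c : Finset X} {x : X} (hA : SetShatters {F | F ∈ 𝓕 ∧ F ∩ ↑b = ↑c} (A : Set X))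
    (hx : x ∈ b) (hxA : x ∉ A)
    (hfree : ∀ S ⊆ A, ∃ F ∈ 𝓕, F ∩ ↑A = ↑S ∧ (x ∈ F ∧ x ∉ c ∨ x ∉ F ∧ x ∈ c)) :
    SetShatters 𝓕 (↑(insert x A) : Set X) := by
  classical
  intro U hU
  suffices h : ∃ F ∈ 𝓕, F ∩ ↑A = U ∩ ↑A ∧ (x ∈ F ↔ x ∈ U) by
    obtain ⟨F, hF, hFA, hFx⟩ := h
    refine ⟨F, hF, ?_⟩
    rw [← Set.inter_eq_left.mpr hU, Finset.coe_insert]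
    ext y
    have hy := Set.ext_iff.mp hFA y
    simp only [Set.mem_inter_iff, Set.mem_insert_iff] at hy ⊢
    by_cases hyx : y = x
    · subst hyx
      tauto
    · tauto
  by_cases hUx : x ∈ U ↔ x ∈ c
  · obtain ⟨F, ⟨hF, hFb⟩, hFA⟩ := hA (U ∩ ↑A) Set.inter_subset_right
    refine ⟨F, hF, hFA, ?_⟩
    have hxF := Set.ext_iff.mp hFb x
    simp only [Set.mem_inter_iff, Finset.mem_coe] at hxF
    tauto
  · obtain ⟨F, hF, hFA, hFx⟩ := hfree (A.filter (· ∈ U)) (Finset.filter_subset _ _)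
    refine ⟨F, hF, ?_, by tauto⟩
    rw [hFA]
    ext y
    simp [and_comm]

/-- The key inductive step: if `𝓕` is a nonempty family of subsets of a finite set `X`
(`|X| ≥ k` where `k = 2^n * (n-1) + 1`, `n ≥ 1`) of VC dimension at most `n`, and
`(b, c)` with `|b| = k`, `c ⊆ b` is chosen so that `𝓕_{b,c} = {F ∈ 𝓕 : F ∩ b = c}` is
nonempty of minimal cardinality, then `𝓕_{b,c}` has VC dimension at most `n - 1`. -/
theorem vcDimLE_of_minimal_trace_family {X : Type*} [Fintype X] (n : ℕ) (hn : 1 ≤ n)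
    (hX : 2 ^ n * (n - 1) + 1 ≤ Fintype.card X)
    (𝓕 : Set (Set X)) (h𝓕 : 𝓕.Nonempty) (hVC : VCDimLE 𝓕 n)
    (b c : Finset X) (hb : b.card = 2 ^ n * (n - 1) + 1) (hcb : c ⊆ b)
    (hne : {F | F ∈ 𝓕 ∧ F ∩ ↑b = ↑c}.Nonempty)
    (hmin : ∀ b' c' : Finset X, b'.card = 2 ^ n * (n - 1) + 1 → c' ⊆ b' →
      {F | F ∈ 𝓕 ∧ F ∩ ↑b' = ↑c'}.Nonempty →
      {F | F ∈ 𝓕 ∧ F ∩ ↑b = ↑c}.ncard ≤ {F | F ∈ 𝓕 ∧ F ∩ ↑b' = ↑c'}.ncard) :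
    VCDimLE {F | F ∈ 𝓕 ∧ F ∩ ↑b = ↑c} (n - 1) := by
  classical
  intro A hA
  by_contra! hlt
  have hA𝓕 : SetShatters 𝓕 (A : Set X) := fun S hS => by
    obtain ⟨F, hF, hFS⟩ := hA S hS
    exact ⟨F, hF.1, hFS⟩
  have hAcard : A.card = n := by
    have := hVC A hA𝓕
    omega
  have hdisj : Disjoint A b := hA.disjoint_of_inter_eq
  have hforced : ∀ x ∈ b, ∃ S ⊆ A, ∀ F ∈ 𝓕, F ∩ ↑A = ↑S → (x ∈ F ↔ x ∈ c) := by
    intro x hx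
    by_contra! hfree
    have hxA : x ∉ A := fun h => Finset.disjoint_left.mp hdisj h hx
    have hshat := hA.insert_of_free hx hxA hfree
    have := hVC (insert x A) hshat
    rw [Finset.card_insert_of_notMem hxA] at this
    omega
  choose! S hSA hS using hforced
  obtain ⟨T, hT, hTcard⟩ := Finset.exists_lt_card_fiber_of_mul_lt_card_of_maps_to
    (s := b) (t := A.powerset) (f := S) (n := n - 1)
    (fun x hx => Finset.mem_powerset.mpr (hSA x hx)) (by
      rw [Finset.card_powerset, hAcard, hb]
      omega)
  have hTA := Finset.mem_powerset.mp hT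
  obtain ⟨Y, hY, hYcard⟩ := Finset.exists_subset_card_eq
    (show n ≤ (b.filter fun x => S x = T).card by omega)
  have hYb : Y ⊆ b := fun x hx => (Finset.mem_filter.mp (hY hx)).1
  have hYT : ∀ x ∈ Y, ∀ F ∈ 𝓕, F ∩ ↑A = ↑T → (x ∈ F ↔ x ∈ c) := fun x hx F hF hFT =>
    hS x (hYb hx) F hF (by rw [(Finset.mem_filter.mp (hY hx)).2, hFT])
  have hcard : ((b \ Y) ∪ A).card = 2 ^ n * (n - 1) + 1 := by
    have hle := Finset.card_le_card hYb
    rw [Finset.card_union_of_disjoint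
      (hdisj.symm.mono_left Finset.sdiff_subset), Finset.card_sdiff_of_subset hYb]
    omega
  have htrace : ∀ F : Set X, F ∩ ↑((b \ Y) ∪ A) = ↑((c \ Y) ∪ T) ↔
      F ∩ ↑(b \ Y) = ↑(c \ Y) ∧ F ∩ ↑A = ↑T := fun F => by
    have hd : ∀ x ∈ A, x ∉ b := fun x hx => Finset.disjoint_left.mp hdisj hx
    simp only [Set.ext_iff, Set.mem_inter_iff, Finset.mem_coe, Finset.mem_union,
      Finset.mem_sdiff, ← forall_and]
    refine forall_congr' fun x => ?_
    have h1 := hd x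
    have h2 := @hcb x
    have h3 := @hTA x
    tauto
  have hsub : {F | F ∈ 𝓕 ∧ F ∩ ↑((b \ Y) ∪ A) = ↑((c \ Y) ∪ T)} ⊆
      {F | F ∈ 𝓕 ∧ F ∩ ↑b = ↑c} := by
    rintro F ⟨hF, hFT⟩
    obtain ⟨h1, h2⟩ := (htrace F).mp hFT
    refine ⟨hF, Set.ext fun x => ?_⟩
    have hx := Set.ext_iff.mp h1 x
    have hxY := fun h => hYT x h F hF h2
    have hxb := @hYb x
    have hxc := @hcb x
    simp only [Set.mem_inter_iff, Finset.mem_coe, Finset.mem_sdiff] at hx ⊢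
    clear * - hx hxY hxb hxc
    by_cases h : x ∈ Y
    · have := hxY h
      tauto
    · simp only [h, not_false_eq_true, and_true] at hx
      exact hx
  have hnonempty : {F | F ∈ 𝓕 ∧ F ∩ ↑((b \ Y) ∪ A) = ↑((c \ Y) ∪ T)}.Nonempty := by
    obtain ⟨F, ⟨hF, hFb⟩, hFT⟩ := hA T (Finset.coe_subset.mpr hTA)
    refine ⟨F, hF, (htrace F).mpr ⟨?_, hFT⟩⟩
    rw [Finset.coe_sdiff, Finset.coe_sdiff, ← Set.inter_sdiff_assoc, hFb]
  have heq := Set.eq_of_subset_of_ncard_le hsub (hmin _ _ hcard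
    (Finset.union_subset_union (Finset.sdiff_subset_sdiff hcb le_rfl) hTA) hnonempty)
    (Set.toFinite _)
  obtain ⟨a, ha⟩ : A.Nonempty := Finset.card_pos.mp (by omega)
  have hconst : ∀ U : Set X, U ⊆ ↑A → U = ↑T := by
    intro U hU
    obtain ⟨F, hF, hFU⟩ := hA U hU
    rw [← heq] at hF
    rw [← hFU, ((htrace F).mp hF.2).2]
  have hempty : (∅ : Set X) = ↑A :=
    (hconst ∅ (Set.empty_subset _)).trans (hconst ↑A subset_rfl).symm
  exact (hempty ▸ Finset.mem_coe.mpr ha : a ∈ (∅ : Set X))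
end

section
/- For every d < ω there is N = N(d) < ω such that the following holds. Let A be a finite nonempty set, let 𝓒 be a nonempty family of subsets of A of VC dimension at most d, and let μ be a probability measure on A. Then there exist n ≤ N and a tuple ā = (a_0, …, a_{n−1}) ∈ A^n such that: for every function f which assigns to each ε ∈ {0,1}^n that is realized by 𝓒 on ā a member f(ε) ∈ 𝓒 whose pattern on ā is ε, and for every C ∈ 𝓒, one has μ({a ∈ A : (a ∈ C) ⟺ (a ∈ f(ε^{(ā,C)}))}) ≥ 2/3. -/
/-- `μ : A → ℝ` is a probability measure on the finite set `A`. -/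
def IsProbMeasure {A : Type*} [Fintype A] (μ : A → ℝ) : Prop :=
  (∀ a, 0 ≤ μ a) ∧ ∑ a, μ a = 1

/-- The measure of a subset `S ⊆ A` with respect to `μ`. -/
noncomputable def measOf {A : Type*} [Fintype A] (μ : A → ℝ) (S : Set A) : ℝ :=
  ∑ a, S.indicator μ a

/-- The Boolean pattern that the set `C` cuts on the tuple `ā`. -/
def pattern {A : Type*} {n : ℕ} (abar : Fin n → A) (C : Set A) : Fin n → Prop :=
  fun i => abar i ∈ C

/-- The pattern `ε ∈ {0,1}^n` is realized by the family `𝓒` on the tuple `ā`. -/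
def RealizedBy {A : Type*} {n : ℕ} (𝓒 : Set (Set A)) (abar : Fin n → A)
    (ε : Fin n → Prop) : Prop :=
  ∃ C ∈ 𝓒, ∀ i, (abar i ∈ C ↔ ε i)

section Traces

open Classical in
/-- The traces on the points `e i` of the members of `F`, as subsets of the index type. -/
noncomputable def traces {X ι : Type*} [Fintype ι] (F : Set (Set X)) (e : ι → X) :
    Finset (Finset ι) :=
  {s | ∃ C ∈ F, ∀ i, i ∈ s ↔ e i ∈ C}

theorem mem_traces {X ι : Type*} [Fintype ι] {F : Set (Set X)} {e : ι → X} {s : Finset ι} :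
    s ∈ traces F e ↔ ∃ C ∈ F, ∀ i, i ∈ s ↔ e i ∈ C := by
  simp [traces]

open Classical in
theorem Finset.Shatters.card_le_of_vcDimLE {X ι : Type*} [Fintype ι] {F : Set (Set X)} {d : ℕ}
    (hF : VCDimLE F d) {e : ι → X} {s : Finset ι} (hs : (traces F e).Shatters s) :
    s.card ≤ d := by
  have hinj : Set.InjOn e s := by
    intro i hi j hj hij
    obtain ⟨u, hu, hsu⟩ := hs (t := {i}) (by simpa using hi)
    obtain ⟨C, -, hC⟩ := mem_traces.1 hu
    have hiu : i ∈ s ∩ u := by simp [hsu]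
    have hju : j ∈ s ∩ u := by
      rw [Finset.mem_inter, hC, ← hij, ← hC]
      exact ⟨hj, (Finset.mem_inter.1 hiu).2⟩
    rw [hsu, Finset.mem_singleton] at hju
    exact hju.symm
  rw [← Finset.card_image_of_injOn hinj]
  refine hF _ fun S hS => ?_
  obtain ⟨u, hu, hsu⟩ := hs (t := {i ∈ s | e i ∈ S}) (Finset.filter_subset _ _)
  obtain ⟨C, hCF, hC⟩ := mem_traces.1 hu
  have key : ∀ i ∈ s, (e i ∈ C ↔ e i ∈ S) := fun i hi => by
    have := congrArg (i ∈ ·) hsu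
    simpa [hi, hC] using this
  refine ⟨C, hCF, Set.ext fun x => ⟨?_, fun hx => ?_⟩⟩
  · rintro ⟨hxC, hx⟩
    obtain ⟨i, hi, rfl⟩ := Finset.mem_image.1 (Finset.mem_coe.1 hx)
    exact (key i hi).1 hxC
  · obtain ⟨i, hi, rfl⟩ := Finset.mem_image.1 (Finset.mem_coe.1 (hS hx))
    exact ⟨(key i hi).2 hx, hS hx⟩

/-- A polynomial form of the Sauer–Shelah bound for traces on a tuple. -/
theorem card_traces_le {X ι : Type*} [Fintype ι] {F : Set (Set X)} {d : ℕ}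
    (hF : VCDimLE F d) (e : ι → X) :
    (traces F e).card ≤ (d + 1) * (Fintype.card ι + 1) ^ d := by
  classical
  have hv : (traces F e).vcDim ≤ d := Finset.sup_le fun s hs =>
    (Finset.mem_shatterer.1 hs).card_le_of_vcDimLE hF
  calc (traces F e).card ≤ ∑ k ∈ Finset.Iic (traces F e).vcDim, (Fintype.card ι).choose k :=
        (Finset.card_le_card_shatterer _).trans Finset.card_shatterer_le_sum_vcDim
    _ ≤ ∑ k ∈ Finset.Iic d, (Fintype.card ι + 1) ^ d := by
        refine (Finset.sum_le_sum_of_subset (Finset.Iic_subset_Iic.2 hv)).trans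
          (Finset.sum_le_sum fun k hk => ?_)
        calc (Fintype.card ι).choose k ≤ Fintype.card ι ^ k := Nat.choose_le_pow _ _
          _ ≤ (Fintype.card ι + 1) ^ k := Nat.pow_le_pow_left (Nat.le_succ _) _
          _ ≤ (Fintype.card ι + 1) ^ d :=
            Nat.pow_le_pow_right (Nat.succ_pos _) (Finset.mem_Iic.1 hk)
    _ = _ := by simp

end Traces

section Symmetrization

/-- The permutation of `ι × Bool` exchanging the two copies of `i` whenever `σ i` holds. -/
def swapPairs {ι : Type*} (σ : ι → Bool) : Equiv.Perm (ι × Bool) :=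
  Function.Involutive.toPerm (fun p => (p.1, xor p.2 (σ p.1))) fun p => by simp

@[simp]
theorem swapPairs_apply {ι : Type*} (σ : ι → Bool) (p : ι × Bool) :
    swapPairs σ p = (p.1, xor p.2 (σ p.1)) :=
  rfl

/-- There are few `σ` such that, after exchanging pairs by `σ`, the set `τ` misses the first half
of `ι × Bool` and meets the second half at least `t` times. -/
theorem card_swaps_le {ι : Type*} [Fintype ι] [DecidableEq ι] (τ : Finset (ι × Bool)) (t : ℕ) :
    ({σ : ι → Bool | (∀ i, swapPairs σ (i, false) ∉ τ) ∧
      t ≤ ({i | swapPairs σ (i, true) ∈ τ} : Finset ι).card} : Finset (ι → Bool)).card * 2 ^ t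
      ≤ 2 ^ Fintype.card ι := by
  rcases Finset.eq_empty_or_nonempty ({σ : ι → Bool | (∀ i, swapPairs σ (i, false) ∉ τ) ∧
      t ≤ ({i | swapPairs σ (i, true) ∈ τ} : Finset ι).card} : Finset (ι → Bool)) with h | ⟨ρ, hρ⟩
  · rw [h]
    simp
  obtain ⟨-, h0, ht⟩ := Finset.mem_filter.1 hρ
  set T : Finset ι := {i | swapPairs ρ (i, true) ∈ τ} with hT
  have hsub : ({σ : ι → Bool | (∀ i, swapPairs σ (i, false) ∉ τ) ∧
      t ≤ ({i | swapPairs σ (i, true) ∈ τ} : Finset ι).card} : Finset (ι → Bool)) ⊆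
      Fintype.piFinset fun i => if i ∈ T then {ρ i} else Finset.univ := by
    intro σ hσ
    obtain ⟨-, hσ0, -⟩ := Finset.mem_filter.1 hσ
    refine Fintype.mem_piFinset.2 fun i => ?_
    split_ifs with hi
    · have h1 : (i, !ρ i) ∈ τ := by simpa [hT] using hi
      have h2 : (i, σ i) ∉ τ := by simpa using hσ0 i
      rw [Finset.mem_singleton]
      by_contra hne
      exact h2 (by rwa [Bool.eq_not_of_ne hne])
    · exact Finset.mem_univ _
  have hcard : (Fintype.piFinset fun i => if i ∈ T then {ρ i} else Finset.univ).card
      = 2 ^ (Fintype.card ι - T.card) := by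
    rw [Fintype.card_piFinset, ← Finset.card_compl, ← Finset.prod_const,
      ← Finset.prod_mul_prod_compl T]
    rw [Finset.prod_eq_one, one_mul]
    · refine Finset.prod_congr rfl fun i hi => ?_
      simp [Finset.mem_compl.1 hi]
    · intro i hi
      simp [hi]
  calc _ ≤ 2 ^ (Fintype.card ι - T.card) * 2 ^ T.card :=
        Nat.mul_le_mul ((Finset.card_le_card hsub).trans hcard.le)
          (Nat.pow_le_pow_right two_pos ht)
    _ = 2 ^ Fintype.card ι := by
        rw [← pow_add, Nat.sub_add_cancel (Finset.card_le_univ T)]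

/-- The double sample `z` witnesses that some two members of `F` agree on its first half but
disagree at least `t` times on its second half. -/
def IsBadSample {A ι : Type*} (F : Set (Set A)) (t : ℕ) (z : ι × Bool → A) : Prop :=
  ∃ C ∈ F, ∃ C' ∈ F, (∀ i, z (i, false) ∉ symmDiff C C') ∧
    t ≤ {i | z (i, true) ∈ symmDiff C C'}.ncard

open Classical in
theorem card_bad_swaps_le {A ι : Type*} [Fintype ι] [DecidableEq ι] {F : Set (Set A)} {d : ℕ}
    (hF : VCDimLE F d) (t : ℕ) (z : ι × Bool → A) :
    ({σ | IsBadSample F t (z ∘ swapPairs σ)} : Finset (ι → Bool)).card * 2 ^ t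
      ≤ ((d + 1) * (2 * Fintype.card ι + 1) ^ d) ^ 2 * 2 ^ Fintype.card ι := by
  set P := traces F z ×ˢ traces F z
  have hsub : ({σ | IsBadSample F t (z ∘ swapPairs σ)} : Finset (ι → Bool)) ⊆
      P.biUnion fun p => {σ : ι → Bool | (∀ i, swapPairs σ (i, false) ∉ symmDiff p.1 p.2) ∧
        t ≤ ({i | swapPairs σ (i, true) ∈ symmDiff p.1 p.2} : Finset ι).card} := by
    intro σ hσ
    obtain ⟨C, hC, C', hC', h0, ht⟩ := (Finset.mem_filter.1 hσ).2
    refine Finset.mem_biUnion.2 ⟨(Finset.univ.filter (z · ∈ C), Finset.univ.filter (z · ∈ C')),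
      Finset.mem_product.2 ⟨mem_traces.2 ⟨C, hC, by simp⟩, mem_traces.2 ⟨C', hC', by simp⟩⟩, ?_⟩
    refine Finset.mem_filter.2 ⟨Finset.mem_univ _, fun i => ?_, ?_⟩
    · simpa [Finset.mem_symmDiff, Set.mem_symmDiff] using h0 i
    · refine ht.trans_eq ?_
      rw [← Set.ncard_coe_finset]
      congr 1
      ext i
      simp [Finset.mem_symmDiff, Set.mem_symmDiff]
  have hP : P.card ≤ ((d + 1) * (2 * Fintype.card ι + 1) ^ d) ^ 2 := by
    have := card_traces_le hF z
    rw [Fintype.card_prod, Fintype.card_bool, mul_comm (Fintype.card ι)] at this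
    rw [Finset.card_product, sq]
    exact Nat.mul_le_mul this this
  calc _ ≤ (∑ p ∈ P, _) * 2 ^ t := Nat.mul_le_mul_right _
        ((Finset.card_le_card hsub).trans Finset.card_biUnion_le)
    _ ≤ ∑ p ∈ P, 2 ^ Fintype.card ι := by
        rw [Finset.sum_mul]
        exact Finset.sum_le_sum fun p _ => by convert card_swaps_le (symmDiff p.1 p.2) t
    _ ≤ _ := by
        rw [Finset.sum_const, smul_eq_mul]
        exact Nat.mul_le_mul_right _ hP

end Symmetrization

section Sampling

variable {A : Type*} [Fintype A] {μ : A → ℝ}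

theorem sum_prod_eq_one {ι : Type*} [Fintype ι] [DecidableEq ι] (hμ : IsProbMeasure μ) :
    ∑ x : ι → A, ∏ i, μ (x i) = 1 := by
  rw [← Fintype.prod_sum fun (_ : ι) a => μ a]
  simp [hμ.2]

theorem sum_prod_indicator {ι : Type*} [Fintype ι] [DecidableEq ι] (hμ : IsProbMeasure μ)
    (D : Set A) (i : ι) :
    ∑ x : ι → A, (∏ j, μ (x j)) * D.indicator 1 (x i) = measOf μ D := by
  have h : ∀ x : ι → A, (∏ j, μ (x j)) * D.indicator 1 (x i)
      = ∏ j, if j = i then D.indicator μ (x j) else μ (x j) := fun x => by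
    rw [← Finset.mul_prod_erase _ _ (Finset.mem_univ i),
      ← Finset.mul_prod_erase _ _ (Finset.mem_univ i), if_pos rfl]
    rw [Finset.prod_congr rfl fun j hj => if_neg (Finset.ne_of_mem_erase hj)]
    by_cases hx : x i ∈ D <;> simp [hx]
  simp_rw [h]
  rw [← Fintype.prod_sum fun j a => if j = i then D.indicator μ a else μ a,
    ← Finset.mul_prod_erase _ _ (Finset.mem_univ i), Finset.prod_eq_one]
  · simp [measOf]
  · intro j hj
    simp [Finset.ne_of_mem_erase hj, hμ.2]

theorem measOf_add_measOf_compl (hμ : IsProbMeasure μ) (S : Set A) :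
    measOf μ S + measOf μ Sᶜ = 1 := by
  simp only [measOf, ← Finset.sum_add_distrib, Set.indicator_self_add_compl_apply, hμ.2]

/-- A double sample as a pair of samples. -/
def doubleSampleEquiv (ι A : Type*) : (ι × Bool → A) ≃ (ι → A) × (ι → A) where
  toFun z := (fun i => z (i, false), fun i => z (i, true))
  invFun p := fun j => cond j.2 (p.2 j.1) (p.1 j.1)
  left_inv z := by ext ⟨i, b⟩; cases b <;> rfl
  right_inv p := rfl

theorem sum_doubleSample {ι : Type*} [Fintype ι] [DecidableEq ι]
    (g : (ι → A) → (ι → A) → ℝ) :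
    ∑ z : ι × Bool → A, (∏ j, μ (z j)) * g (fun i => z (i, false)) (fun i => z (i, true))
      = ∑ x : ι → A, (∏ i, μ (x i)) * ∑ y : ι → A, (∏ i, μ (y i)) * g x y := by
  rw [Fintype.sum_equiv (doubleSampleEquiv ι A) _
    (fun p => ((∏ i, μ (p.1 i)) * ∏ i, μ (p.2 i)) * g p.1 p.2), Fintype.sum_prod_type]
  · simp_rw [Finset.mul_sum, mul_assoc]
  · intro z
    simp [doubleSampleEquiv, Fintype.prod_prod_type, Finset.prod_mul_distrib, mul_comm]

theorem sum_comp_swapPairs {ι : Type*} [Fintype ι] [DecidableEq ι] (σ : ι → Bool)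
    (g : (ι × Bool → A) → ℝ) :
    ∑ z : ι × Bool → A, (∏ j, μ (z j)) * g (z ∘ swapPairs σ)
      = ∑ z : ι × Bool → A, (∏ j, μ (z j)) * g z := by
  refine Fintype.sum_equiv ((swapPairs σ).symm.arrowCongr (Equiv.refl A)) _ _ fun z => ?_
  congr 1
  exact (Equiv.prod_comp (swapPairs σ) fun j => μ (z j)).symm

theorem sum_badSample_le {ι : Type*} [Fintype ι] [DecidableEq ι] {F : Set (Set A)} {d : ℕ}
    (hF : VCDimLE F d) (hμ : IsProbMeasure μ) (t : ℕ) :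
    (∑ z : ι × Bool → A, (∏ j, μ (z j)) * {z | IsBadSample F t z}.indicator 1 z) * 2 ^ t
      ≤ (((d + 1) * (2 * Fintype.card ι + 1) ^ d) ^ 2 : ℕ) := by
  classical
  set g : (ι × Bool → A) → ℝ := {z | IsBadSample F t z}.indicator 1
  set M : ℕ := ((d + 1) * (2 * Fintype.card ι + 1) ^ d) ^ 2
  have hpos : (0 : ℝ) < 2 ^ Fintype.card ι := by positivity
  have hswap : ∀ z : ι × Bool → A,
      (∑ σ : ι → Bool, g (z ∘ swapPairs σ)) * 2 ^ t ≤ M * 2 ^ Fintype.card ι := fun z => by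
    have h : ∑ σ : ι → Bool, g (z ∘ swapPairs σ)
        = ({σ | IsBadSample F t (z ∘ swapPairs σ)} : Finset (ι → Bool)).card := by
      simp [g, Set.indicator_apply, Finset.sum_boole]
    rw [h]
    exact_mod_cast card_bad_swaps_le hF t z
  refine le_of_mul_le_mul_left ?_ hpos
  calc 2 ^ Fintype.card ι * ((∑ z : ι × Bool → A, (∏ j, μ (z j)) * g z) * 2 ^ t)
      = (∑ σ : ι → Bool, ∑ z : ι × Bool → A, (∏ j, μ (z j)) * g (z ∘ swapPairs σ)) * 2 ^ t := by
        simp [sum_comp_swapPairs, mul_assoc]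
    _ = ∑ z : ι × Bool → A, (∏ j, μ (z j)) * ((∑ σ : ι → Bool, g (z ∘ swapPairs σ)) * 2 ^ t) := by
        rw [Finset.sum_comm, Finset.sum_mul]
        simp_rw [← Finset.mul_sum, mul_assoc]
    _ ≤ ∑ z : ι × Bool → A, (∏ j, μ (z j)) * (M * 2 ^ Fintype.card ι) :=
        Finset.sum_le_sum fun z _ => mul_le_mul_of_nonneg_left (hswap z)
          (Finset.prod_nonneg fun j _ => hμ.1 _)
    _ = 2 ^ Fintype.card ι * M := by
        rw [← Finset.sum_mul, sum_prod_eq_one hμ, one_mul, mul_comm]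

/-- If the sample size is large compared with the VC dimension, some sample separates any two
members of the family which are far apart. -/
theorem exists_separating_tuple {ι : Type*} [Fintype ι] {F : Set (Set A)} {d t : ℕ}
    (hF : VCDimLE F d) (hμ : IsProbMeasure μ) (ht : 0 < t) (hι : Fintype.card ι = 6 * t)
    (hdt : 6 * ((d + 1) * (12 * t + 1) ^ d) ^ 2 < 2 ^ t) :
    ∃ x : ι → A, ∀ C ∈ F, ∀ C' ∈ F, (∀ i, x i ∉ symmDiff C C') →
      measOf μ (symmDiff C C') ≤ 1 / 3 := by
  classical
  by_contra! hbad
  choose C hC C' hC' hx hlarge using hbad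
  set D : (ι → A) → Set A := fun x => symmDiff (C x) (C' x)
  have hlower : (2 * t : ℝ) ≤ ∑ z : ι × Bool → A, (∏ j, μ (z j)) *
      ∑ i, (D fun i => z (i, false)).indicator 1 (z (i, true)) := by
    rw [sum_doubleSample fun x y => ∑ i, (D x).indicator 1 (y i)]
    calc (2 * t : ℝ) = ∑ x : ι → A, (∏ i, μ (x i)) * (2 * t) := by
          rw [← Finset.sum_mul, sum_prod_eq_one hμ, one_mul]
      _ ≤ _ := Finset.sum_le_sum fun x _ => mul_le_mul_of_nonneg_left ?_
          (Finset.prod_nonneg fun j _ => hμ.1 _)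
    simp_rw [Finset.mul_sum]
    rw [Finset.sum_comm]
    simp_rw [sum_prod_indicator hμ (D x)]
    rw [Finset.sum_const, Finset.card_univ, hι, nsmul_eq_mul]
    push_cast
    have : (0 : ℝ) ≤ t := t.cast_nonneg
    nlinarith [hlarge x]
  have hupper : ∀ z : ι × Bool → A,
      ∑ i, (D fun i => z (i, false)).indicator 1 (z (i, true))
        ≤ t + 6 * t * ({z | IsBadSample F t z}.indicator 1 z : ℝ) := fun z => by
    have hcard : ∑ i, (D fun i => z (i, false)).indicator 1 (z (i, true))
        = (({i | z (i, true) ∈ D fun i => z (i, false)} : Finset ι).card : ℝ) := by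
      simp [Set.indicator_apply, Finset.sum_boole]
    rw [hcard]
    by_cases hz : IsBadSample F t z
    · rw [Set.indicator_of_mem (by exact hz)]
      have : (({i | z (i, true) ∈ D fun i => z (i, false)} : Finset ι).card : ℝ) ≤ (6 * t : ℕ) :=
        Nat.cast_le.2 (hι ▸ Finset.card_le_univ _)
      push_cast at this
      simp only [Pi.one_apply, mul_one]
      linarith [(t.cast_nonneg : (0 : ℝ) ≤ t)]
    · rw [Set.indicator_of_notMem (by exact hz), mul_zero, add_zero, Nat.cast_le]
      by_contra! hlt
      refine hz ⟨_, hC _, _, hC' _, hx fun i => z (i, false), hlt.le.trans_eq ?_⟩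
      rw [← Set.ncard_coe_finset]
      congr 1
      ext i
      simp [D]
  have hsum : (2 * t : ℝ) ≤ t + 6 * t * ∑ z : ι × Bool → A,
      (∏ j, μ (z j)) * {z | IsBadSample F t z}.indicator 1 z := by
    refine hlower.trans ((Finset.sum_le_sum fun z _ => mul_le_mul_of_nonneg_left (hupper z)
      (Finset.prod_nonneg fun j _ => hμ.1 _)).trans_eq ?_)
    simp_rw [mul_add, Finset.sum_add_distrib, ← Finset.sum_mul, sum_prod_eq_one hμ, one_mul,
      Finset.mul_sum]
    congr 1
    exact Finset.sum_congr rfl fun z _ => by ring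
  have hle := sum_badSample_le (ι := ι) hF hμ t
  rw [hι, show 2 * (6 * t) = 12 * t by ring] at hle
  set q := ∑ z : ι × Bool → A, (∏ j, μ (z j)) * {z | IsBadSample F t z}.indicator 1 z
  have hdt' : (6 * (((d + 1) * (12 * t + 1) ^ d) ^ 2 : ℕ) : ℝ) < 2 ^ t := by exact_mod_cast hdt
  have ht' : (0 : ℝ) < t := Nat.cast_pos.2 ht
  have hq : 1 ≤ 6 * q := by
    by_contra! h
    nlinarith
  have : (2 : ℝ) ^ t ≤ 6 * q * 2 ^ t := le_mul_of_one_le_left (by positivity) hq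
  linarith

end Sampling

theorem exists_sq_polynomial_lt_two_pow (d : ℕ) :
    ∃ t : ℕ, 0 < t ∧ 6 * ((d + 1) * (12 * t + 1) ^ d) ^ 2 < 2 ^ t := by
  have hlim := tendsto_pow_const_div_const_pow_of_one_lt (d * 2) (one_lt_two : (1 : ℝ) < 2)
  set K : ℝ := 6 * ((d + 1) * 13 ^ d) ^ 2 with hK
  have hKpos : 0 < K := by positivity
  obtain ⟨t, ht, htpos⟩ := ((hlim.eventually_lt_const (inv_pos.2 hKpos)).and
    (Filter.eventually_gt_atTop 0)).exists
  refine ⟨t, htpos, ?_⟩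
  rw [div_lt_iff₀ (by positivity), inv_mul_eq_div, lt_div_iff₀ hKpos] at ht
  have h13 : 12 * t + 1 ≤ 13 * t := by omega
  have hle : 6 * ((d + 1) * (12 * t + 1) ^ d) ^ 2 ≤ 6 * ((d + 1) * (13 * t) ^ d) ^ 2 := by gcongr
  refine hle.trans_lt ?_
  have : ((6 * ((d + 1) * (13 * t) ^ d) ^ 2 : ℕ) : ℝ) < (2 ^ t : ℕ) := by
    push_cast
    refine lt_of_eq_of_lt ?_ ht
    rw [hK, mul_pow 13, pow_mul]
    ring
  exact_mod_cast this

/-- For every `d` there is `N = N(d)` such that for every finite nonempty set `A`, every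
nonempty family `𝓒` of subsets of `A` of VC dimension at most `d` and every probability
measure `μ` on `A`, there is a tuple `ā ∈ A^n` with `n ≤ N` such that for every choice
function `f` picking, for each pattern `ε` realized by `𝓒` on `ā`, a member of `𝓒` with
pattern `ε` on `ā`, and every `C ∈ 𝓒`, the set of `a ∈ A` on which `C` and
`f(ε^{(ā,C)})` agree has `μ`-measure at least `2/3`. -/
theorem exists_good_tuple (d : ℕ) :
    ∃ N : ℕ, ∀ (A : Type*) [Fintype A] [Nonempty A] (𝓒 : Set (Set A)) (μ : A → ℝ),
      𝓒.Nonempty → VCDimLE 𝓒 d → IsProbMeasure μ →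
      ∃ n ≤ N, ∃ abar : Fin n → A,
        ∀ f : (Fin n → Prop) → Set A,
          (∀ ε : Fin n → Prop, RealizedBy 𝓒 abar ε →
            f ε ∈ 𝓒 ∧ ∀ i, (abar i ∈ f ε ↔ ε i)) →
          ∀ C ∈ 𝓒,
            (2 : ℝ) / 3 ≤ measOf μ {a | a ∈ C ↔ a ∈ f (pattern abar C)} := by
  obtain ⟨t, ht, hdt⟩ := exists_sq_polynomial_lt_two_pow d
  refine ⟨6 * t, fun A _ _ 𝓒 μ _ hF hμ => ?_⟩
  obtain ⟨x, hx⟩ := exists_separating_tuple (ι := Fin (6 * t)) hF hμ ht (Fintype.card_fin _) hdt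
  refine ⟨6 * t, le_rfl, x, fun f hf C hC => ?_⟩
  obtain ⟨hfC, hagree⟩ := hf (pattern x C) ⟨C, hC, fun i => Iff.rfl⟩
  have hagree' : ∀ i, x i ∈ f (pattern x C) ↔ x i ∈ C := hagree
  have hsmall := hx C hC _ hfC fun i => by simp [Set.mem_symmDiff, hagree' i]
  have hcompl : {a | a ∈ C ↔ a ∈ f (pattern x C)}ᶜ = symmDiff C (f (pattern x C)) := by
    ext a
    simp only [Set.mem_compl_iff, Set.mem_ofPred_eq, Set.mem_symmDiff]
    tauto
  have hsum := measOf_add_measOf_compl hμ {a | a ∈ C ↔ a ∈ f (pattern x C)}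
  rw [hcompl] at hsum
  linarith
end

section
/- For every d < ω there is J = J(d) < ω such that the following holds for every N < ω. Let A be a finite nonempty set, let 𝓒 be a nonempty family of subsets of A of VC dimension at most d, let C* ∈ 𝓒, and for each n ≤ N let f_n be a function which assigns to each pair (ā, ε), where ā ∈ A^n and ε ∈ {0,1}^n is realized by 𝓒 on ā, a member f_n(ā, ε) ∈ 𝓒 whose pattern on ā is ε. Assume that for every probability measure μ on A there exist n ≤ N and ā ∈ A^n with μ({a ∈ A : (a ∈ C*) ⟺ (a ∈ f_n(ā, ε^{(ā,C*)}))}) ≥ 2/3. Then there exist m with 1 ≤ m ≤ J, lengths n_0, …, n_{m−1} ≤ N, and tuples ā_t ∈ A^{n_t} for t < m, such that for every a ∈ A, the number of indices t < m with (a ∈ C*) ⟺ (a ∈ f_{n_t}(ā_t, ε^{(ā_t,C*)})) is strictly greater than m/2. -/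
open Finset Classical in
/-- Hoeffding's inequality for Rademacher sums, in counting form. -/
theorem card_signs_le {ι : Type*} [Fintype ι] (c : ι → ℝ) (hc : ∀ i, |c i| ≤ 1)
    {δ : ℝ} (hδ : 0 ≤ δ) :
    (#{σ : ι → Bool | Fintype.card ι * δ ≤ ∑ i, if σ i then c i else -c i} : ℝ) ≤
      2 ^ Fintype.card ι * Real.exp (-(Fintype.card ι * δ ^ 2 / 2)) := by
  set n := Fintype.card ι
  have upper : ∑ σ : ι → Bool, Real.exp (δ * ∑ i, if σ i then c i else -c i) ≤
      2 ^ n * Real.exp (n * (δ ^ 2 / 2)) := by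
    calc ∑ σ : ι → Bool, Real.exp (δ * ∑ i, if σ i then c i else -c i)
        = ∑ σ : ι → Bool, ∏ i, Real.exp (δ * if σ i then c i else -c i) := by
          simp only [mul_sum, Real.exp_sum]
      _ = ∏ i, ∑ b : Bool, Real.exp (δ * if b then c i else -c i) :=
          (Fintype.prod_sum fun i (b : Bool) => Real.exp (δ * if b then c i else -c i)).symm
      _ ≤ ∏ _i : ι, 2 * Real.exp (δ ^ 2 / 2) := by
          refine prod_le_prod (fun i _ => sum_nonneg fun b _ => (Real.exp_pos _).le) fun i _ => ?_
          have hcosh := Real.cosh_le_exp_half_sq (δ * c i)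
          have hci : (δ * c i) ^ 2 / 2 ≤ δ ^ 2 / 2 := by
            have : c i ^ 2 ≤ 1 := (sq_le_one_iff_abs_le_one _).2 (hc i)
            nlinarith [sq_nonneg δ]
          have hexp := Real.exp_le_exp.2 hci
          rw [Real.cosh_eq] at hcosh
          simp only [Fintype.sum_bool, if_true, Bool.false_eq_true, if_false, mul_neg]
          linarith
      _ = 2 ^ n * Real.exp (n * (δ ^ 2 / 2)) := by
          rw [prod_const, card_univ, mul_pow, ← Real.exp_nat_mul]
  have lower : (#{σ : ι → Bool | n * δ ≤ ∑ i, if σ i then c i else -c i} : ℝ) *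
      Real.exp (n * δ ^ 2) ≤ ∑ σ : ι → Bool, Real.exp (δ * ∑ i, if σ i then c i else -c i) := by
    rw [← nsmul_eq_mul, ← sum_const]
    refine le_trans (sum_le_sum fun σ hσ => ?_)
      (sum_le_sum_of_subset_of_nonneg (subset_univ _) fun _ _ _ => (Real.exp_pos _).le)
    have hσ' := (mem_filter.1 hσ).2
    have hmul := mul_le_mul_of_nonneg_left hσ' hδ
    exact Real.exp_le_exp.2 (by linarith)
  have hsplit : Real.exp (n * (δ ^ 2 / 2)) =
      Real.exp (-(n * δ ^ 2 / 2)) * Real.exp (n * δ ^ 2) := by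
    rw [← Real.exp_add]; ring_nf
  have := lower.trans upper
  rw [hsplit, ← mul_assoc] at this
  exact le_of_mul_le_mul_right this (Real.exp_pos _)

open Finset Classical in
/-- Choosing one point from each of `n` pairs so that every member of a small family of sets
keeps about half of its points. -/
theorem exists_selector {ι : Type*} [Fintype ι] (U : Finset (Finset (ι × Bool)))
    {δ : ℝ} (hδ : 0 ≤ δ)
    (hU : (#U : ℝ) * Real.exp (-(Fintype.card ι * δ ^ 2 / 2)) < 1) :
    ∃ σ : ι → Bool, ∀ u ∈ U,
      (#u : ℝ) < 2 * #{i | (i, σ i) ∈ u} + Fintype.card ι * δ := by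
  by_contra! hbad
  let ind (u : Finset (ι × Bool)) (i : ι) (b : Bool) : ℝ := if (i, b) ∈ u then 1 else 0
  let c (u : Finset (ι × Bool)) (i : ι) : ℝ := ind u i false - ind u i true
  have hc u i : |c u i| ≤ 1 := by
    simp only [c, ind]; split_ifs <;> norm_num
  have hcover : (univ : Finset (ι → Bool)) ⊆ U.biUnion fun u =>
      {σ | Fintype.card ι * δ ≤ ∑ i, if σ i then c u i else -c u i} := by
    intro σ _
    obtain ⟨u, hu, h⟩ := hbad σ
    refine mem_biUnion.2 ⟨u, hu, mem_filter.2 ⟨mem_univ _, ?_⟩⟩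
    have hfull : (#u : ℝ) = ∑ i, (ind u i true + ind u i false) := by
      have : (#u : ℝ) = ∑ q : ι × Bool, if q ∈ u then (1 : ℝ) else 0 := by simp
      simp only [this, Fintype.sum_prod_type, Fintype.sum_bool, ind]
    have hhalf : (#{i | (i, σ i) ∈ u} : ℝ) = ∑ i, ind u i (σ i) := by simp [ind]
    have hsum : ∑ i, (if σ i then c u i else -c u i) =
        ∑ i, (ind u i true + ind u i false) - 2 * ∑ i, ind u i (σ i) := by
      rw [mul_sum, ← sum_sub_distrib]
      refine sum_congr rfl fun i _ => ?_
      cases σ i <;> simp [c] <;> ring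
    linarith
  have hcard := (card_le_card hcover).trans card_biUnion_le
  have hreal : (2 : ℝ) ^ Fintype.card ι ≤ ∑ u ∈ U,
      (#{σ : ι → Bool | Fintype.card ι * δ ≤ ∑ i, if σ i then c u i else -c u i} : ℝ) := by
    have : Fintype.card (ι → Bool) = 2 ^ Fintype.card ι := by simp
    rw [card_univ, this] at hcard
    exact_mod_cast hcard
  have := hreal.trans (sum_le_sum fun u _ => card_signs_le (c u) (hc u) hδ)
  rw [sum_const, nsmul_eq_mul] at this
  have h2 : (0 : ℝ) < 2 ^ Fintype.card ι := by positivity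
  nlinarith

/-- No `D` members of the family `E` are cut by the points of `A` in all possible ways. -/
def DualShatterFree {H A : Type*} (E : H → Set A) (D : ℕ) : Prop :=
  ∀ h : Fin D → H, ∃ W : Set (Fin D), ∀ a, ∃ v, ¬(a ∈ E (h v) ↔ v ∈ W)

/-- If `𝓒` has VC dimension at most `d`, then the agreement sets of its members with a fixed
set have dual VC dimension less than `2 ^ (d + 1)`. -/
theorem VCDimLE.dualShatterFree {A : Type*} {𝓒 : Set (Set A)} {d : ℕ} (h𝓒 : VCDimLE 𝓒 d)
    {H : Type*} (g : H → Set A) (hg : ∀ h, g h ∈ 𝓒) (Cstar : Set A) :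
    DualShatterFree (fun h => {a | a ∈ Cstar ↔ a ∈ g h}) (2 ^ (d + 1)) := by
  classical
  intro h
  by_contra! hW
  let e : Set (Fin (d + 1)) ≃ Fin (2 ^ (d + 1)) := Fintype.equivOfCardEq (by simp)
  choose pt hpt using hW
  let p (i : Fin (d + 1)) : A := pt {v | i ∈ e.symm v}
  have hp (V : Set (Fin (d + 1))) (i) : (p i ∈ Cstar ↔ p i ∈ g (h (e V))) ↔ i ∈ V := by
    have := hpt {v | i ∈ e.symm v} (e V)
    simpa using this
  have hinj : Function.Injective p := by
    intro i j hij
    have hi := hp {i} i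
    have hj := hp {i} j
    rw [hij] at hi
    have : j ∈ ({i} : Set _) := hj.1 (hi.2 rfl)
    exact this.symm
  have hshat : SetShatters 𝓒 ↑(Finset.univ.map ⟨p, hinj⟩) := by
    intro S hS
    refine ⟨g (h (e {i | p i ∈ Cstar ↔ p i ∈ S})), hg _, ?_⟩
    have key i : p i ∈ g (h (e {i | p i ∈ Cstar ↔ p i ∈ S})) ↔ p i ∈ S := by
      have := hp {i | p i ∈ Cstar ↔ p i ∈ S} i
      simp only [Set.mem_ofPred_eq] at this
      tauto
    ext a
    constructor
    · rintro ⟨ha, hB⟩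
      obtain ⟨i, -, rfl⟩ := Finset.mem_map.1 hB
      exact (key i).1 ha
    · intro ha
      obtain ⟨i, -, rfl⟩ := Finset.mem_map.1 (hS ha)
      exact ⟨(key i).2 ha, hS ha⟩
  have := h𝓒 _ hshat
  simp at this

theorem Nat.sum_choose_le_pow (n D : ℕ) : ∑ k ∈ Finset.Iic D, n.choose k ≤ (n + 1) ^ D := by
  have hIic : Finset.Iic D = Finset.range (D + 1) := by ext; simp
  rw [hIic, add_pow]
  refine Finset.sum_le_sum fun k hk => ?_
  have hkD : 0 < D.choose k := Nat.choose_pos (by simpa [Nat.lt_succ_iff] using hk)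
  simpa using (Nat.choose_le_pow n k).trans (Nat.le_mul_of_pos_right _ hkD)

open Finset Classical in
/-- The Sauer–Shelah bound for the dual family. -/
theorem DualShatterFree.card_traces_le {H A : Type*} {E : H → Set A} {D : ℕ}
    (hE : DualShatterFree E D) {κ : Type*} [Fintype κ] (x : κ → H) :
    #{u : Finset κ | ∃ a, ∀ j, j ∈ u ↔ a ∈ E (x j)} ≤ (Fintype.card κ + 1) ^ D := by
  set U : Finset (Finset κ) := {u | ∃ a, ∀ j, j ∈ u ↔ a ∈ E (x j)}
  have hdim : U.vcDim ≤ D := by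
    refine Finset.sup_le fun s hs => ?_
    by_contra! hlt
    obtain ⟨t, hts, htD⟩ := exists_subset_card_eq hlt.le
    have hsh : U.Shatters t := (mem_shatterer.1 hs).mono_right hts
    let e := (t.equivFinOfCardEq htD).symm
    obtain ⟨W, hW⟩ := hE fun v => x (e v)
    obtain ⟨u, hu, hut⟩ := hsh (t := (univ.filter (· ∈ W)).map
      ⟨fun v => (e v : κ), fun v w h => e.injective (Subtype.ext h)⟩) (by
        intro j hj
        obtain ⟨v, -, rfl⟩ := mem_map.1 hj
        exact (e v).2)
    obtain ⟨a, ha⟩ := (mem_filter.1 hu).2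
    obtain ⟨v, hv⟩ := hW a
    apply hv
    rw [← ha]
    have : (e v : κ) ∈ t ∩ u ↔ v ∈ W := by
      simp only [hut, mem_map, mem_filter_univ]
      exact ⟨fun ⟨w, hw, h⟩ => e.injective (Subtype.ext h) ▸ hw, fun h => ⟨v, h, rfl⟩⟩
    simpa using this
  calc #U ≤ ∑ k ∈ Iic U.vcDim, (Fintype.card κ).choose k :=
        (card_le_card_shatterer U).trans card_shatterer_le_sum_vcDim
    _ ≤ ∑ k ∈ Iic D, (Fintype.card κ).choose k :=
        sum_le_sum_of_subset (Iic_subset_Iic.2 hdim)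
    _ ≤ _ := Nat.sum_choose_le_pow _ _

open Finset Classical in
theorem DualShatterFree.exists_half {H A : Type*} {E : H → Set A} {D : ℕ}
    (hE : DualShatterFree E D) {ι κ : Type*} [Fintype ι] [Fintype κ]
    (hικ : Fintype.card κ = Fintype.card ι * 2) (x : κ → H) {δ : ℝ} (hδ : 0 ≤ δ)
    (hD : ((Fintype.card κ : ℝ) + 1) ^ D * Real.exp (-(Fintype.card ι * δ ^ 2 / 2)) < 1) :
    ∃ y : ι → H, ∀ a, (#{j | a ∈ E (x j)} : ℝ) <
      2 * #{i | a ∈ E (y i)} + Fintype.card ι * δ := by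
  let e : ι × Bool ≃ κ := Fintype.equivOfCardEq (by simp [hικ])
  have hcard := hE.card_traces_le fun q => x (e q)
  rw [Fintype.card_congr e] at hcard
  obtain ⟨σ, hσ⟩ := exists_selector
    {u : Finset (ι × Bool) | ∃ a, ∀ j, j ∈ u ↔ a ∈ E (x (e j))} hδ
    (lt_of_le_of_lt (mul_le_mul_of_nonneg_right (by exact_mod_cast hcard)
      (Real.exp_pos _).le) hD)
  refine ⟨fun i => x (e (i, σ i)), fun a => ?_⟩
  have := hσ {q | a ∈ E (x (e q))} (by simp only [mem_filter_univ]; exact ⟨a, by simp⟩)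
  have hfull : #{q | a ∈ E (x (e q))} = #{j | a ∈ E (x j)} :=
    card_equiv e (by simp)
  rw [hfull] at this
  simpa using this

open Filter Topology in
/-- Sample sizes `2 ^ (p + k)` from which halving with error `(3 / 4) ^ k / 72` is possible. -/
theorem exists_halving_threshold (D : ℕ) : ∃ p : ℕ, ∀ k : ℕ,
    ((2 : ℝ) ^ (p + k + 1) + 1) ^ D *
      Real.exp (-(2 ^ (p + k) * ((3 / 4) ^ k / 72) ^ 2 / 2)) < 1 := by
  have hlim : Tendsto (fun p : ℕ => (D : ℝ) * ((p : ℝ) ^ 1 / 2 ^ p + 2 * ((p : ℝ) ^ 0 / 2 ^ p)))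
      atTop (𝓝 ((D : ℝ) * (0 + 2 * 0))) :=
    ((tendsto_pow_const_div_const_pow_of_one_lt 1 one_lt_two).add
      ((tendsto_pow_const_div_const_pow_of_one_lt 0 one_lt_two).const_mul 2)).const_mul _
  obtain ⟨p, hp⟩ := (hlim.eventually_lt_const (u := 1 / 82944) (by norm_num)).exists
  refine ⟨p, fun k => ?_⟩
  have h2p : (0 : ℝ) < 2 ^ p := by positivity
  have hp' : (D : ℝ) * (p + 2) < 2 ^ p / 82944 := by
    have : (D : ℝ) * ((p : ℝ) ^ 1 / 2 ^ p + 2 * ((p : ℝ) ^ 0 / 2 ^ p)) =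
        D * (p + 2) / 2 ^ p := by field_simp
    rw [this, div_lt_iff₀ h2p] at hp
    linarith
  have hbase : (2 : ℝ) ^ (p + k + 1) + 1 ≤ Real.exp (p + k + 2) := by
    have h1 : (1 : ℝ) ≤ 2 ^ (p + k + 1) := one_le_pow₀ one_le_two
    have h2 : (2 : ℝ) ≤ Real.exp 1 := by linarith [Real.add_one_le_exp 1]
    calc (2 : ℝ) ^ (p + k + 1) + 1 ≤ 2 ^ (p + k + 2) := by
          rw [pow_succ _ (p + k + 1)]; linarith
      _ ≤ Real.exp 1 ^ (p + k + 2) := pow_le_pow_left₀ zero_le_two h2 _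
      _ = Real.exp (p + k + 2) := by rw [← Real.exp_nat_mul]; push_cast; ring_nf
  have hpow : ((2 : ℝ) ^ (p + k + 1) + 1) ^ D ≤ Real.exp (D * (p + k + 2)) := by
    rw [Real.exp_nat_mul]
    exact pow_le_pow_left₀ (by positivity) hbase _
  have hgrow : (2 : ℝ) ^ (p + k) * ((3 / 4) ^ k / 72) ^ 2 / 2 = 2 ^ p * (9 / 8) ^ k / 10368 := by
    have : (9 / 8 : ℝ) ^ k = 2 ^ k * ((3 / 4) ^ k) ^ 2 := by
      rw [← pow_mul, mul_comm k 2, pow_mul, ← mul_pow]; norm_num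
    rw [this, pow_add]; ring
  have hbern : 1 + (k : ℝ) * (1 / 8) ≤ (9 / 8) ^ k := by
    have := one_add_mul_le_pow (a := (1 / 8 : ℝ)) (by norm_num) k
    norm_num at this ⊢
    exact this
  have hk : (0 : ℝ) ≤ k := k.cast_nonneg
  have hD0 : (0 : ℝ) ≤ D := D.cast_nonneg
  have hp0 : (0 : ℝ) ≤ p := p.cast_nonneg
  refine (mul_le_mul_of_nonneg_right hpow (Real.exp_pos _).le).trans_lt ?_
  rw [← Real.exp_add, Real.exp_lt_one_iff, hgrow]
  have h1 : (D : ℝ) * (p + k + 2) ≤ D * (p + 2) * (1 + k) := by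
    nlinarith [mul_nonneg hD0 (mul_nonneg hk hp0), mul_nonneg hD0 hk]
  have h2 : (D : ℝ) * (p + 2) * (1 + k) < 2 ^ p / 82944 * (1 + k) :=
    mul_lt_mul_of_pos_right hp' (by linarith)
  have h3 : (2 : ℝ) ^ p * (1 + k * (1 / 8)) ≤ 2 ^ p * (9 / 8) ^ k :=
    mul_le_mul_of_nonneg_left hbern h2p.le
  nlinarith

open Finset Classical in
/-- Iterated halving of a long sequence of sets that covers every point with frequency at least
`5 / 9`. -/
theorem DualShatterFree.exists_majority {H A : Type*} {E : H → Set A} {D p : ℕ}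
    (hE : DualShatterFree E D)
    (hp : ∀ k : ℕ, ((2 : ℝ) ^ (p + k + 1) + 1) ^ D *
      Real.exp (-(2 ^ (p + k) * ((3 / 4) ^ k / 72) ^ 2 / 2)) < 1) (k : ℕ)
    (x : Fin (2 ^ (p + k)) → H)
    (hx : ∀ a, (2 : ℝ) ^ (p + k) * (5 / 9 - (3 / 4) ^ k / 36) ≤ #{j | a ∈ E (x j)}) :
    ∃ y : Fin (2 ^ p) → H, ∀ a, 2 ^ p < 2 * #{j | a ∈ E (y j)} := by
  induction k with
  | zero =>
    refine ⟨x, fun a => ?_⟩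
    have h2p : (0 : ℝ) < 2 ^ p := by positivity
    have : (2 : ℝ) ^ p < 2 * #{j | a ∈ E (x j)} := by
      have := hx a
      norm_num at this
      linarith
    exact_mod_cast this
  | succ k ih =>
    obtain ⟨y, hy⟩ := hE.exists_half (ι := Fin (2 ^ (p + k))) (by simp [pow_succ, ← add_assoc]) x
      (δ := (3 / 4) ^ k / 72) (by positivity) (by simpa [← add_assoc] using hp k)
    refine ih y fun a => ?_
    have h1 := hx a
    have h2 := hy a
    have h3 : (2 : ℝ) ^ (p + (k + 1)) = 2 ^ (p + k) * 2 := by rw [← add_assoc, pow_succ]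
    rw [h3, pow_succ] at h1
    simp only [Fintype.card_fin, Nat.cast_pow, Nat.cast_ofNat] at h2
    nlinarith

open Finset Classical in
/-- The multiplicative weights argument. -/
theorem exists_sequence_prod_le {H A : Type*} [Fintype A] (E : H → Set A)
    (hE : ∀ w : A → ℝ, (∀ a, 0 < w a) → ∃ h, 2 / 3 * ∑ a, w a ≤ ∑ a, (E h).indicator w a)
    (T : ℕ) : ∃ x : Fin T → H,
      ∑ a, (1 / 2 : ℝ) ^ #{t | a ∈ E (x t)} ≤ Fintype.card A * (2 / 3) ^ T := by
  induction T with
  | zero => exact ⟨Fin.elim0, by simp⟩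
  | succ T ih =>
    obtain ⟨x, hx⟩ := ih
    obtain ⟨h, hh⟩ := hE (fun a => (1 / 2 : ℝ) ^ #{t | a ∈ E (x t)}) fun a => by positivity
    refine ⟨Fin.cons h x, ?_⟩
    have hstep a : (1 / 2 : ℝ) ^ #{t | a ∈ E ((Fin.cons h x : Fin (T + 1) → H) t)} =
        (1 / 2 : ℝ) ^ #{t | a ∈ E (x t)} -
          1 / 2 * (E h).indicator (fun a => (1 / 2 : ℝ) ^ #{t | a ∈ E (x t)}) a := by
      rw [Fin.card_filter_univ_succ]
      by_cases ha : a ∈ E h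
      · simp [ha, pow_succ]; ring
      · simp [ha]
    simp only [hstep]
    rw [sum_sub_distrib, ← mul_sum, pow_succ]
    linarith

open Finset Classical Filter Topology in
theorem exists_forall_frequency_ge {H A : Type*} [Fintype A] (E : H → Set A)
    (hE : ∀ w : A → ℝ, (∀ a, 0 < w a) → ∃ h, 2 / 3 * ∑ a, w a ≤ ∑ a, (E h).indicator w a) :
    ∃ T₀ : ℕ, ∀ T ≥ T₀, ∃ x : Fin T → H, ∀ a, 5 * T ≤ 9 * #{t | a ∈ E (x t)} := by
  have hlim : Tendsto (fun T : ℕ => (Fintype.card A : ℝ) ^ 9 * ((2 / 3) ^ 9 * 2 ^ 5) ^ T)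
      atTop (𝓝 ((Fintype.card A : ℝ) ^ 9 * 0)) :=
    (tendsto_pow_atTop_nhds_zero_of_lt_one (by norm_num) (by norm_num)).const_mul _
  obtain ⟨T₀, hT₀⟩ := eventually_atTop.1 (hlim.eventually_lt_const (u := 1) (by norm_num))
  refine ⟨T₀, fun T hT => ?_⟩
  obtain ⟨x, hx⟩ := exists_sequence_prod_le E hE T
  refine ⟨x, fun a => ?_⟩
  by_contra! hlt
  have h1 : (1 / 2 : ℝ) ^ #{t | a ∈ E (x t)} ≤ Fintype.card A * (2 / 3) ^ T :=
    (single_le_sum (f := fun a => (1 / 2 : ℝ) ^ #{t | a ∈ E (x t)})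
      (fun a _ => by positivity) (mem_univ a)).trans hx
  have h2 := pow_le_pow_left₀ (by positivity) h1 9
  have h3 : (1 / 2 : ℝ) ^ (5 * T) ≤ ((1 / 2 : ℝ) ^ #{t | a ∈ E (x t)}) ^ 9 := by
    rw [← pow_mul]
    exact pow_le_pow_of_le_one (by norm_num) (by norm_num) (by omega)
  have h4 := mul_le_mul_of_nonneg_right (h3.trans h2) (by positivity : (0 : ℝ) ≤ 2 ^ (5 * T))
  have h5 : (1 / 2 : ℝ) ^ (5 * T) * 2 ^ (5 * T) = 1 := by rw [← mul_pow]; norm_num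
  have h6 : ((Fintype.card A : ℝ) * (2 / 3) ^ T) ^ 9 * 2 ^ (5 * T) =
      Fintype.card A ^ 9 * ((2 / 3) ^ 9 * 2 ^ 5) ^ T := by
    rw [mul_pow, mul_pow, ← pow_mul, ← pow_mul, ← pow_mul, mul_comm T 9, mul_assoc]
  rw [h5, h6] at h4
  exact absurd (hT₀ T hT) (not_lt.2 h4)

/-- Translation of Claim 3.1 of Moran–Yehudayoff: for every `d` there is `J = J(d)` such
that whenever `𝓒` is a nonempty family of subsets of a finite nonempty set `A` of VC
dimension at most `d`, `C* ∈ 𝓒`, and `(f_n)_{n ≤ N}` is a system of "Skolem" choice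
functions (picking, for each tuple `ā ∈ A^n` and each pattern `ε` realized by `𝓒` on
`ā`, a member of `𝓒` with pattern `ε` on `ā`) such that every probability measure `μ`
on `A` admits some `n ≤ N` and `ā ∈ A^n` with
`μ({a : a ∈ C* ↔ a ∈ f_n(ā, ε^{(ā,C*)})}) ≥ 2/3`, then there are `1 ≤ m ≤ J` and tuples
`ā_t ∈ A^{n_t}` (`n_t ≤ N`, `t < m`) such that every `a ∈ A` satisfies
`a ∈ C* ↔ a ∈ f_{n_t}(ā_t, ε^{(ā_t,C*)})` for strictly more than `m/2` indices `t`. -/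
theorem claim_three_one (d : ℕ) :
    ∃ J : ℕ, ∀ (N : ℕ) (A : Type*) [Fintype A] [Nonempty A]
      (𝓒 : Set (Set A)) (Cstar : Set A)
      (f : (n : ℕ) → (Fin n → A) → (Fin n → Prop) → Set A),
      𝓒.Nonempty → VCDimLE 𝓒 d → Cstar ∈ 𝓒 →
      (∀ n ≤ N, ∀ (abar : Fin n → A) (ε : Fin n → Prop), RealizedBy 𝓒 abar ε →
        f n abar ε ∈ 𝓒 ∧ ∀ i, (abar i ∈ f n abar ε ↔ ε i)) →
      (∀ μ : A → ℝ, IsProbMeasure μ →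
        ∃ n ≤ N, ∃ abar : Fin n → A,
          (2 : ℝ) / 3 ≤
            measOf μ {a | a ∈ Cstar ↔ a ∈ f n abar (pattern abar Cstar)}) →
      ∃ m : ℕ, 1 ≤ m ∧ m ≤ J ∧
        ∃ ns : Fin m → ℕ, (∀ t, ns t ≤ N) ∧
          ∃ abar : (t : Fin m) → Fin (ns t) → A,
            ∀ a : A, m < 2 * Set.ncard {t : Fin m |
              a ∈ Cstar ↔ a ∈ f (ns t) (abar t) (pattern (abar t) Cstar)} := by
  obtain ⟨p, hp⟩ := exists_halving_threshold (2 ^ (d + 1))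
  refine ⟨2 ^ p, fun N A _ _ 𝓒 Cstar f _ hVC hCstar hf hμ => ?_⟩
  let H := {q : Σ n : ℕ, Fin n → A // q.1 ≤ N}
  let g (q : H) : Set A := f q.1.1 q.1.2 (pattern q.1.2 Cstar)
  have hg (q : H) : g q ∈ 𝓒 := (hf _ q.2 _ _ ⟨Cstar, hCstar, fun _ => Iff.rfl⟩).1
  let E (q : H) : Set A := {a | a ∈ Cstar ↔ a ∈ g q}
  have hfree : DualShatterFree E (2 ^ (d + 1)) := hVC.dualShatterFree g hg Cstar
  have hE (w : A → ℝ) (hw : ∀ a, 0 < w a) :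
      ∃ h, 2 / 3 * ∑ a, w a ≤ ∑ a, (E h).indicator w a := by
    have hpos : 0 < ∑ a, w a := Finset.sum_pos (fun a _ => hw a) Finset.univ_nonempty
    obtain ⟨n, hn, abar, h⟩ := hμ (fun a => (∑ a, w a)⁻¹ * w a)
      ⟨fun a => by have := hw a; positivity, by rw [← Finset.mul_sum, inv_mul_cancel₀ hpos.ne']⟩
    refine ⟨⟨⟨n, abar⟩, hn⟩, ?_⟩
    simp only [measOf, Set.indicator_const_mul, ← Finset.mul_sum] at h
    rw [inv_mul_eq_div, le_div_iff₀ hpos] at h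
    exact h
  obtain ⟨T₀, hT₀⟩ := exists_forall_frequency_ge E hE
  obtain ⟨x, hx⟩ := hT₀ (2 ^ (p + T₀))
    (Nat.lt_two_pow_self.le.trans (Nat.pow_le_pow_right two_pos (Nat.le_add_left _ _)))
  obtain ⟨y, hy⟩ := hfree.exists_majority hp T₀ x fun a => by
    have h1 := (Nat.cast_le (α := ℝ)).2 (hx a)
    push_cast at h1
    have h2 : (0 : ℝ) ≤ 2 ^ (p + T₀) * ((3 / 4) ^ T₀ / 36) := by positivity
    linarith
  refine ⟨2 ^ p, Nat.one_le_two_pow, le_rfl, fun t => (y t).1.1, fun t => (y t).2,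
    fun t => (y t).1.2, fun a => ?_⟩
  have := hy a
  rwa [← Set.ncard_coe_finset, Finset.coe_filter_univ] at this
end

section
/- Let L be a first-order language, T an L-theory, M ⊨ T, and let ψ(x,y) and θ(x,z) be L-formulas with free variables partitioned as indicated. Let a ∈ M^y and a' ∈ M^z, and suppose ψ(x,a) is equivalent to θ(x,a') in M (i.e. for all b ∈ M^x, M ⊨ ψ(b,a) ⟺ M ⊨ θ(b,a')), and that θ(x,z) is stable in T. Then there is an L-formula ψ'(x,y) which is stable in T and such that ψ'(x,a) is equivalent to ψ(x,a) in M. -/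
open FirstOrder Language

universe u v

/-- `φ(x, y)` is stable in `T`: there is `n` such that no model of `T` contains an
order-witnessing ladder `(b_i, a_j)_{i,j < n}` for `φ`. -/
def FormulaStable {L : FirstOrder.Language.{u, v}} {α β : Type*} (T : L.Theory)
    (φ : L.Formula (α ⊕ β)) : Prop :=
  ∃ n : ℕ, ∀ (N : Type (max u v)) [L.Structure N] [Nonempty N], N ⊨ T →
    ∀ (b : Fin n → α → N) (a : Fin n → β → N),
      ¬ ∀ i j : Fin n, (φ.Realize (Sum.elim (b i) (a j)) ↔ i ≤ j)

/-- The formula `ψ(x, y) ∧ ∃ z, ∀ x, (ψ(x, y) ↔ θ(x, z))`. -/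
noncomputable def restrictToInstances {L : FirstOrder.Language.{u, v}} {α β γ : Type*}
    [Finite α] [Finite γ] (ψ : L.Formula (α ⊕ β)) (θ : L.Formula (α ⊕ γ)) :
    L.Formula (α ⊕ β) :=
  ψ ⊓ Formula.iExs γ (Formula.iAlls α
    (((ψ.relabel (Sum.elim Sum.inr (Sum.inl ∘ Sum.inl ∘ Sum.inr))).iff
      (θ.relabel (Sum.elim Sum.inr (Sum.inl ∘ Sum.inr)))) :
      L.Formula (((α ⊕ β) ⊕ γ) ⊕ α)))

theorem realize_restrictToInstances {L : FirstOrder.Language.{u, v}} {α β γ M : Type*}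
    [Finite α] [Finite γ] [L.Structure M] (ψ : L.Formula (α ⊕ β)) (θ : L.Formula (α ⊕ γ))
    (b : α → M) (a : β → M) :
    (restrictToInstances ψ θ).Realize (Sum.elim b a) ↔
      ψ.Realize (Sum.elim b a) ∧
        ∃ c : γ → M, ∀ b' : α → M,
          (ψ.Realize (Sum.elim b' a) ↔ θ.Realize (Sum.elim b' c)) := by
  simp only [restrictToInstances, Formula.realize_inf, Formula.realize_iExs,
    Formula.realize_iAlls, Formula.realize_iff, Formula.realize_relabel, Sum.comp_elim]
  rfl

theorem FormulaStable.restrictToInstances {L : FirstOrder.Language.{u, v}} {α β γ : Type*}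
    [Finite α] [Finite γ] {T : L.Theory} (ψ : L.Formula (α ⊕ β)) {θ : L.Formula (α ⊕ γ)}
    (hθ : FormulaStable T θ) : FormulaStable T (restrictToInstances ψ θ) := by
  obtain ⟨n, hn⟩ := hθ
  refine ⟨n, fun N _ _ hN b a h => ?_⟩
  simp only [realize_restrictToInstances] at h
  choose c hc using fun j => ((h j j).2 le_rfl).2
  refine hn N hN b c fun i j => ?_
  rw [← hc j (b i), ← h i j]
  exact ⟨fun hi => ⟨hi, c j, hc j⟩, And.left⟩

/-- If `ψ(x, a)` is equivalent in a model `M ⊨ T` to an instance `θ(x, a')` of a formula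
`θ(x, z)` which is stable in `T`, then there is a formula `ψ'(x, y)`, stable in `T`,
such that `ψ'(x, a)` is equivalent to `ψ(x, a)` in `M`. -/
theorem exists_stable_equivalent {L : FirstOrder.Language.{u, v}} {nx ny nz : ℕ}
    (T : L.Theory) (M : Type (max u v)) [L.Structure M] [Nonempty M] (hM : M ⊨ T)
    (ψ : L.Formula (Fin nx ⊕ Fin ny)) (θ : L.Formula (Fin nx ⊕ Fin nz))
    (a : Fin ny → M) (a' : Fin nz → M)
    (hequiv : ∀ b : Fin nx → M,
      ψ.Realize (Sum.elim b a) ↔ θ.Realize (Sum.elim b a'))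
    (hθ : FormulaStable T θ) :
    ∃ ψ' : L.Formula (Fin nx ⊕ Fin ny), FormulaStable T ψ' ∧
      ∀ b : Fin nx → M, (ψ'.Realize (Sum.elim b a) ↔ ψ.Realize (Sum.elim b a)) := by
  refine ⟨restrictToInstances ψ θ, hθ.restrictToInstances ψ, fun b => ?_⟩
  rw [realize_restrictToInstances]
  exact and_iff_left ⟨a', hequiv⟩
end
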